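/- Let (a,b) ∈ ℝ² be Diophantine, f(x) = ax + b, let 𝓘 ⊂ ℝ be a compact interval, and let ε ∈ (0,1). Then there exist constants 0 < c₁ < c₂ < 1 and c₀ > 0 (depending on a, b, 𝓘, ε but not on J) such that for every subinterval J ⊆ 𝓘 there is T₁ = T₁(J) with the following property: for all (t,s) ∈ (ℤ_{>0})² with c₁ s ≤ t ≤ c₂ s and s + t ≥ T₁, the Lebesgue measure of {x ∈ J : the lattice a(t,s) u(f(x), x) ℤ³ contains a nonzero vector v with ‖v‖ ≤ ε (s+t)^{−2/3}} is at least c₀ |J| ε³ (s+t)^{−2}. -/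

import Mathlib

/-!
Positive proportion of well-approximable points at each scale
(Chow–Yang, the measure lower bound (3.5) for the sets `B*(t,s) ⊆ B_ε(t,s) ∩ J`):
for a Diophantine vector `(a,b)`, a compact interval `𝓘` and `ε ∈ (0,1)`,
there are constants `0 < c₁ < c₂ < 1` and `c₀ > 0` such that for every
subinterval `J ⊆ 𝓘` there is a threshold `T₁(J)` with
`|B_ε(t,s) ∩ J| ≥ c₀ |J| ε³ (s+t)^{-2}` for all integer pairs `(t,s)` with
`c₁ s ≤ t ≤ c₂ s` and `s + t ≥ T₁`.
-/

open MeasureTheory Matrix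

noncomputable section

/-- Distance from a real number to the nearest integer, `⟨x⟩`. -/
def distNearestInt (x : ℝ) : ℝ := |x - round x|

/-- `(a, b) ∈ ℝ²` is Diophantine:
`inf_{q ∈ ℕ} q^{1/2+κ} max(⟨qa⟩, ⟨qb⟩) > 0` for some `κ > 0`. -/
def IsDiophantine (a b : ℝ) : Prop :=
  ∃ κ : ℝ, 0 < κ ∧ ∃ δ : ℝ, 0 < δ ∧ ∀ q : ℕ, 0 < q →
    δ ≤ (q : ℝ) ^ ((1 : ℝ) / 2 + κ) *
      max (distNearestInt (q * a)) (distNearestInt (q * b))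

/-- The diagonal matrix `a(t,s) = diag(e^t, e^s, e^{-t-s})`. -/
def aM (t s : ℝ) : Matrix (Fin 3) (Fin 3) ℝ :=
  !![Real.exp t, 0, 0; 0, Real.exp s, 0; 0, 0, Real.exp (-t - s)]

/-- The unipotent matrix `u(y,x)` with rows `(1,0,y), (0,1,x), (0,0,1)`. -/
def uM (y x : ℝ) : Matrix (Fin 3) (Fin 3) ℝ := !![1, 0, y; 0, 1, x; 0, 0, 1]


def PPNear (x η : ℝ) : Prop := ∃ m : ℤ, |x - m| ≤ η

theorem pp_sep {ι : Type*} (S : Finset ι) (f : ι → ℝ) (s c l : ℝ) (hs : 0 < s) (hl : 0 ≤ l)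
    (hsep : ∀ x ∈ S, ∀ y ∈ S, x ≠ y → s ≤ |f x - f y|)
    (h1 : ∀ x ∈ S, c ≤ f x) (h2 : ∀ x ∈ S, f x ≤ c + l) :
    (S.card : ℝ) ≤ l / s + 1 := by
  classical
  have hinj : Set.InjOn (fun x => ⌊(f x - c) / s⌋₊) (S : Set ι) := by
    intro x hx y hy hxy
    by_contra hne
    have h := hsep x hx y hy hne
    simp only at hxy
    have hx0 : 0 ≤ (f x - c) / s := div_nonneg (by linarith [h1 x hx]) hs.le
    have hy0 : 0 ≤ (f y - c) / s := div_nonneg (by linarith [h1 y hy]) hs.le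
    have a1 := Nat.floor_le hx0
    have a2 := Nat.lt_floor_add_one ((f x - c) / s)
    have a3 := Nat.floor_le hy0
    have a4 := Nat.lt_floor_add_one ((f y - c) / s)
    rw [hxy] at a1 a2
    have h3 : |(f x - c) / s - (f y - c) / s| < 1 := by
      rw [abs_lt]; constructor <;> linarith
    have h4 : (f x - c) / s - (f y - c) / s = (f x - f y) / s := by ring
    rw [h4, abs_div, abs_of_pos hs, div_lt_one hs] at h3
    linarith
  have hmaps : ∀ x ∈ S, ⌊(f x - c) / s⌋₊ ∈ Finset.range (⌊l / s⌋₊ + 1) := by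
    intro x hx
    rw [Finset.mem_range, Nat.lt_succ_iff]
    apply Nat.floor_le_floor
    gcongr
    linarith [h2 x hx]
  have := Finset.card_le_card_of_injOn _ hmaps hinj
  rw [Finset.card_range] at this
  have h5 : (S.card : ℝ) ≤ ⌊l / s⌋₊ + 1 := by exact_mod_cast this
  have := Nat.floor_le (div_nonneg hl hs.le)
  linarith

theorem pp_sepInt (S : Finset ℤ) (c l : ℝ) (hl : 0 ≤ l)
    (h1 : ∀ x ∈ S, c ≤ (x : ℝ)) (h2 : ∀ x ∈ S, (x : ℝ) ≤ c + l) :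
    (S.card : ℝ) ≤ l + 1 := by
  have := pp_sep S (fun x => (x : ℝ)) 1 c l one_pos hl ?_ h1 h2
  · simpa using this
  · intro x _ y _ hne
    have : (1 : ℤ) ≤ |x - y| := Int.one_le_abs (sub_ne_zero.mpr hne)
    exact_mod_cast this

theorem pp_fib {ι κ : Type*} [DecidableEq κ] (S : Finset ι) (g : ι → κ) (w c : ℝ) (hc : 0 ≤ c)
    (hw : ((S.image g).card : ℝ) ≤ w)
    (hf : ∀ y ∈ S.image g, ((S.filter (fun x => g x = y)).card : ℝ) ≤ c) :
    (S.card : ℝ) ≤ w * c := by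
  rw [Finset.card_eq_sum_card_image g S]
  push_cast
  calc _ ≤ ∑ y ∈ S.image g, c := Finset.sum_le_sum hf
    _ = (S.image g).card * c := by simp
    _ ≤ _ := by gcongr

theorem pp_prog (S : Finset ℤ) (y0 τ η u L : ℝ) (hτ : 0 < τ) (hτ1 : τ ≤ 1) (hη : 0 ≤ η)
    (hη2 : η ≤ 1 / 2) (hL : 0 ≤ L)
    (h1 : ∀ x ∈ S, u ≤ (x : ℝ)) (h2 : ∀ x ∈ S, (x : ℝ) ≤ u + L)
    (hn : ∀ x ∈ S, PPNear (y0 + x * τ) η) :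
    (S.card : ℝ) ≤ (2 * η + τ) * L + 4 / τ := by
  classical
  have hn' : ∀ x : ℤ, ∃ m : ℤ, x ∈ S → |y0 + x * τ - m| ≤ η := by
    intro x
    by_cases hx : x ∈ S
    · obtain ⟨m, hm⟩ := hn x hx
      exact ⟨m, fun _ => hm⟩
    · exact ⟨0, fun h => absurd h hx⟩
  choose g hg using hn'
  have key : (S.card : ℝ) ≤ (τ * L + 2 * η + 1) * (2 * η / τ + 1) := by
    apply pp_fib S g
    · positivity
    · apply pp_sepInt _ (y0 + u * τ - η)
      · positivity
      · intro m hm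
        obtain ⟨x, hx, rfl⟩ := Finset.mem_image.mp hm
        have := (abs_le.mp (hg x hx)).2
        nlinarith [h1 x hx]
      · intro m hm
        obtain ⟨x, hx, rfl⟩ := Finset.mem_image.mp hm
        have := (abs_le.mp (hg x hx)).1
        nlinarith [h2 x hx]
    · intro m _
      apply pp_sepInt _ ((m - η - y0) / τ)
      · positivity
      · intro x hx
        obtain ⟨hxS, rfl⟩ := Finset.mem_filter.mp hx
        have := (abs_le.mp (hg x hxS)).1
        rw [div_le_iff₀ hτ]; linarith
      · intro x hx
        obtain ⟨hxS, rfl⟩ := Finset.mem_filter.mp hx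
        have := (abs_le.mp (hg x hxS)).2
        rw [← add_div, le_div_iff₀ hτ]; linarith
  refine key.trans ?_
  have e : (τ * L + 2 * η + 1) * (2 * η / τ + 1) = (2 * η + τ) * L + (2 * η + 1) * (2 * η + τ) / τ := by
    field_simp
    ring
  rw [e]
  gcongr
  nlinarith

theorem pp_near_neg {x η : ℝ} (h : PPNear x η) : PPNear (-x) η := by
  obtain ⟨m, hm⟩ := h
  refine ⟨-m, ?_⟩
  rw [← abs_neg]; push_cast
  convert hm using 2; ring

theorem pp_near_add {x η : ℝ} (n : ℤ) (h : PPNear (x + n) η) : PPNear x η := by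
  obtain ⟨m, hm⟩ := h
  refine ⟨m - n, ?_⟩
  push_cast
  convert hm using 2; ring

theorem pp_near_compl {x η : ℝ} (h : ¬ PPNear x η) : PPNear (x + 1 / 2) (1 / 2 - η) := by
  have h1 : η < |x - round x| := by
    by_contra hc
    exact h ⟨round x, not_lt.mp hc⟩
  have h2 := abs_sub_round x
  rcases le_total 0 (x - round x) with h0 | h0
  · rw [abs_of_nonneg h0] at h1 h2
    refine ⟨round x + 1, ?_⟩
    push_cast
    rw [abs_le]; constructor <;> linarith
  · rw [abs_of_nonpos h0] at h1 h2
    refine ⟨round x, ?_⟩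
    rw [abs_le]; constructor <;> linarith

/-- signed step -/
theorem pp_prog' (S : Finset ℤ) (y0 θ η u L : ℝ) (n : ℤ) (hτ : 0 < |θ - n|) (hτ1 : |θ - n| ≤ 1)
    (hη : 0 ≤ η) (hη2 : η ≤ 1 / 2) (hL : 0 ≤ L)
    (h1 : ∀ x ∈ S, u ≤ (x : ℝ)) (h2 : ∀ x ∈ S, (x : ℝ) ≤ u + L)
    (hn : ∀ x ∈ S, PPNear (y0 + x * θ) η) :
    (S.card : ℝ) ≤ (2 * η + |θ - n|) * L + 4 / |θ - n| := by
  rcases le_total 0 (θ - n) with h0 | h0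
  · apply pp_prog S y0 _ η u L hτ hτ1 hη hη2 hL h1 h2
    intro x hx
    rw [abs_of_nonneg h0]
    apply pp_near_add (x * n)
    convert hn x hx using 1
    push_cast; ring
  · apply pp_prog S (-y0) _ η u L hτ hτ1 hη hη2 hL h1 h2
    intro x hx
    rw [abs_of_nonpos h0]
    apply pp_near_add (- (x * n))
    convert pp_near_neg (hn x hx) using 1
    push_cast; ring

theorem pp_one (S : Finset ℤ) (hS : ∀ x ∈ S, ∀ y ∈ S, ∀ z, x ≤ z → z ≤ y → z ∈ S)
    (x0 θ η : ℝ) (k : ℕ) (hk : 0 < k) (n : ℤ) (hτ : 0 < |k * θ - n|) (hτ1 : |k * θ - n| ≤ 1)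
    (hη : 0 ≤ η) (hη2 : η ≤ 1 / 2) (T : Finset ℤ) (hT : T ⊆ S)
    (hn : ∀ x ∈ T, PPNear (x0 + x * θ) η) :
    (T.card : ℝ) ≤ (2 * η + |k * θ - n|) * S.card + 4 * k / |k * θ - n| := by
  classical
  rcases T.eq_empty_or_nonempty with rfl | hTn
  · simp; positivity
  have hSn : S.Nonempty := hTn.mono hT
  set a := S.min' hSn
  set b := S.max' hSn
  have hab : a ≤ b := S.min'_le _ (S.max'_mem hSn)
  have hc : Finset.Icc a b ⊆ S := by
    intro z hz
    rw [Finset.mem_Icc] at hz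
    exact hS a (S.min'_mem hSn) b (S.max'_mem hSn) z hz.1 hz.2
  have hcard : ((b : ℝ) - a) ≤ S.card := by
    have h1 := Finset.card_le_card hc
    rw [Int.card_Icc] at h1
    have : b - a ≤ (S.card : ℤ) := by omega
    exact_mod_cast this
  have hkR : (0 : ℝ) < k := by exact_mod_cast hk
  have habR : (a : ℝ) ≤ b := by exact_mod_cast hab
  have key : (T.card : ℝ) ≤ k * ((2 * η + |k * θ - n|) * ((b - a) / k) + 4 / |k * θ - n|) := by
    apply pp_fib T (fun x => x % (k : ℤ))
    · have : 0 ≤ ((b : ℝ) - a) / k := div_nonneg (by linarith) hkR.le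
      positivity
    · have : T.image (fun x => x % (k : ℤ)) ⊆ Finset.Ico 0 (k : ℤ) := by
        intro y hy
        obtain ⟨x, _, rfl⟩ := Finset.mem_image.mp hy
        rw [Finset.mem_Ico]
        exact ⟨Int.emod_nonneg _ (by omega), Int.emod_lt_of_pos _ (by omega)⟩
      have := Finset.card_le_card this
      rw [Int.card_Ico] at this
      have h : (T.image (fun x => x % (k : ℤ))).card ≤ k := by omega
      exact_mod_cast h
    · intro ρ _
      set U := T.filter (fun x => x % (k : ℤ) = ρ)
      have hU : ∀ x ∈ U, x ∈ T ∧ (x : ℝ) = ρ + k * ((x / (k : ℤ) : ℤ) : ℝ) := by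
        intro x hx
        obtain ⟨hx, h⟩ := Finset.mem_filter.mp hx
        refine ⟨hx, ?_⟩
        have := Int.emod_add_mul_ediv x k
        rw [h] at this
        exact_mod_cast this.symm
      have hinj : Set.InjOn (fun x => x / (k : ℤ)) (U : Set ℤ) := by
        intro x hx y hy hxy
        have h1 := (hU x hx).2
        have h2 := (hU y hy).2
        simp only at hxy
        rw [hxy] at h1
        have : (x : ℝ) = y := by linarith
        exact_mod_cast this
      rw [← Finset.card_image_of_injOn hinj]
      apply pp_prog' _ (x0 + ρ * θ) (k * θ) η ((a - ρ) / k) _ n hτ hτ1 hη hη2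
      · exact div_nonneg (by linarith) hkR.le
      · intro i hi
        obtain ⟨x, hx, rfl⟩ := Finset.mem_image.mp hi
        obtain ⟨hxT, hxe⟩ := hU x hx
        have : a ≤ x := S.min'_le _ (hT hxT)
        have : (a : ℝ) ≤ x := by exact_mod_cast this
        rw [div_le_iff₀ hkR]; linarith
      · intro i hi
        obtain ⟨x, hx, rfl⟩ := Finset.mem_image.mp hi
        obtain ⟨hxT, hxe⟩ := hU x hx
        have : x ≤ b := S.le_max' _ (hT hxT)
        have : (x : ℝ) ≤ b := by exact_mod_cast this
        rw [← add_div, le_div_iff₀ hkR]; linarith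
      · intro i hi
        obtain ⟨x, hx, rfl⟩ := Finset.mem_image.mp hi
        obtain ⟨hxT, hxe⟩ := hU x hx
        convert hn x hxT using 1
        rw [hxe]; ring
  refine key.trans ?_
  have e : k * ((2 * η + |k * θ - n|) * ((b - a) / k) + 4 / |k * θ - n|)
      = (2 * η + |k * θ - n|) * (b - a) + 4 * k / |k * θ - n| := by
    field_simp
  rw [e]
  gcongr

theorem pp_two (Ω : Finset (ℤ × ℤ))
    (hrow : ∀ p₁ p₂ p₃ q, (p₁, q) ∈ Ω → (p₃, q) ∈ Ω → p₁ ≤ p₂ → p₂ ≤ p₃ → (p₂, q) ∈ Ω)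
    (W : ℝ) (hW : ((Ω.image Prod.snd).card : ℝ) ≤ W)
    (a b c η : ℝ) (k : ℕ) (hk : 0 < k) (n : ℤ) (hτ : 0 < |k * a - n|) (hτ1 : |k * a - n| ≤ 1)
    (hη : 0 ≤ η) (hη2 : η ≤ 1 / 2) (T : Finset (ℤ × ℤ)) (hT : T ⊆ Ω)
    (hn : ∀ v ∈ T, PPNear (c + v.1 * a + v.2 * b) η) :
    (T.card : ℝ) ≤ (2 * η + |k * a - n|) * Ω.card + W * (4 * k / |k * a - n|) := by
  classical
  have hTc : T.card = ∑ q ∈ Ω.image Prod.snd, (T.filter (fun v => v.2 = q)).card :=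
    Finset.card_eq_sum_card_fiberwise (fun v hv => by
      simpa using ⟨v.1, hT hv⟩)
  have hΩc : Ω.card = ∑ q ∈ Ω.image Prod.snd, (Ω.filter (fun v => v.2 = q)).card :=
    Finset.card_eq_sum_card_image _ _
  have key : ∀ q ∈ Ω.image Prod.snd, ((T.filter (fun v => v.2 = q)).card : ℝ) ≤
      (2 * η + |k * a - n|) * (Ω.filter (fun v => v.2 = q)).card + 4 * k / |k * a - n| := by
    intro q _
    have hi : ∀ U : Finset (ℤ × ℤ), Set.InjOn Prod.fst ((U.filter (fun v => v.2 = q) : Finset (ℤ × ℤ)) : Set (ℤ × ℤ)) := by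
      intro U x hx y hy hxy
      simp only [Finset.coe_filter, Set.mem_ofPred_eq] at hx hy
      exact Prod.ext hxy (hx.2.trans hy.2.symm)
    rw [← Finset.card_image_of_injOn (hi T), ← Finset.card_image_of_injOn (hi Ω)]
    have hm : ∀ (U : Finset (ℤ × ℤ)) (p : ℤ), p ∈ (U.filter (fun v => v.2 = q)).image Prod.fst ↔ (p, q) ∈ U := by
      intro U p
      simp
    apply pp_one _ _ (c + q * b) a η k hk n hτ hτ1 hη hη2
    · intro p hp
      rw [hm] at hp ⊢
      exact hT hp
    · intro p hp
      rw [hm] at hp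
      convert hn _ hp using 1
      simp; ring
    · intro x hx y hy z hxz hzy
      rw [hm] at hx hy ⊢
      exact hrow _ _ _ _ hx hy hxz hzy
  rw [hTc, hΩc]
  push_cast
  refine (Finset.sum_le_sum key).trans ?_
  rw [Finset.sum_add_distrib, ← Finset.mul_sum, Finset.sum_const, nsmul_eq_mul]
  gcongr

theorem pp_dioph {a b : ℝ} (hab : IsDiophantine a b) : ∃ h : ℕ, ∃ δ : ℝ, 0 < δ ∧ δ ≤ 1 ∧
    ∀ E : ℝ, 1 ≤ E → ∀ q : ℕ, 0 < q → (q : ℝ) ≤ E ^ 9 → ∀ m m' : ℤ,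
      δ ≤ E ^ h * max |q * a - m| |q * b - m'| := by
  obtain ⟨κ, hκ, δ, hδ, H⟩ := hab
  obtain ⟨h, hh⟩ := exists_nat_ge (9 * (1 / 2 + κ))
  refine ⟨h, min δ 1, by positivity, min_le_right _ _, ?_⟩
  intro E hE q hq hqE m m'
  refine (min_le_left _ _).trans ((H q hq).trans ?_)
  have hq0 : (0 : ℝ) < q := by exact_mod_cast hq
  have e1 : (q : ℝ) ^ ((1 : ℝ) / 2 + κ) ≤ E ^ h := by
    calc (q : ℝ) ^ ((1 : ℝ) / 2 + κ) ≤ (E ^ 9) ^ ((1 : ℝ) / 2 + κ) := by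
          apply Real.rpow_le_rpow hq0.le hqE; positivity
      _ = E ^ (9 * ((1 : ℝ) / 2 + κ)) := by
          rw [Real.rpow_mul (by linarith)]
          norm_cast
      _ ≤ E ^ (h : ℝ) := Real.rpow_le_rpow_of_exponent_le hE hh
      _ = E ^ h := Real.rpow_natCast _ _
  have e2 : max (distNearestInt (q * a)) (distNearestInt (q * b)) ≤ max |q * a - m| |q * b - m'| :=
    max_le_max (round_le _ _) (round_le _ _)
  apply mul_le_mul e1 e2 _ (by positivity)
  exact le_max_of_le_left (abs_nonneg _)

theorem pp_step {a b E δ : ℝ} {h R d : ℕ} (hE : 1 ≤ E)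
    (H : ∀ q : ℕ, 0 < q → (q : ℝ) ≤ E ^ 9 → ∀ m m' : ℤ,
      δ ≤ E ^ h * max |q * a - m| |q * b - m'|)
    (hR : 0 < R) (hRE : (R : ℝ) ≤ E ^ 3) (hd : 0 < d) (hdE : (d : ℝ) ≤ E ^ 3) :
    ∃ k : ℕ, 0 < k ∧ (k : ℝ) ≤ E ^ 3 ∧
      ((∃ n : ℤ, |k * (d * a) - n| ≤ 1 / R ∧ δ ≤ E ^ (h + 3) * |k * (d * a) - n|) ∨
       (∃ n : ℤ, |k * (d * b) - n| ≤ 1 / R ∧ δ ≤ E ^ (h + 3) * |k * (d * b) - n|)) := by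
  have hR0 : (0 : ℝ) < R := by exact_mod_cast hR
  obtain ⟨k, hk, hkR, hka⟩ := Real.exists_nat_abs_mul_sub_round_le (d * a) hR
  obtain ⟨l, hl, hlR, hlb⟩ := Real.exists_nat_abs_mul_sub_round_le (d * b) hR
  have hkE : (k : ℝ) ≤ E ^ 3 := le_trans (by exact_mod_cast hkR) hRE
  have hlE : (l : ℝ) ≤ E ^ 3 := le_trans (by exact_mod_cast hlR) hRE
  have hRR : (1 : ℝ) / (R + 1) ≤ 1 / R := by gcongr; linarith
  set n := round (k * (d * a))
  set n' := round (l * (d * b))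
  by_cases h1 : δ ≤ E ^ (h + 3) * |k * (d * a) - n|
  · exact ⟨k, hk, hkE, Or.inl ⟨n, hka.trans hRR, h1⟩⟩
  by_cases h2 : δ ≤ E ^ (h + 3) * |l * (d * b) - n'|
  · exact ⟨l, hl, hlE, Or.inr ⟨n', hlb.trans hRR, h2⟩⟩
  exfalso
  push Not at h1 h2
  have := H (k * l * d) (by positivity) (by
    push_cast
    calc (k : ℝ) * l * d ≤ E ^ 3 * E ^ 3 * E ^ 3 := by gcongr
      _ = E ^ 9 := by ring) (l * n) (k * n')
  push_cast at this
  have e1 : |(k : ℝ) * l * d * a - l * n| ≤ E ^ 3 * |k * (d * a) - n| := by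
    have : (k : ℝ) * l * d * a - l * n = l * (k * (d * a) - n) := by ring
    rw [this, abs_mul, Nat.abs_cast]
    gcongr
  have e2 : |(k : ℝ) * l * d * b - k * n'| ≤ E ^ 3 * |l * (d * b) - n'| := by
    have : (k : ℝ) * l * d * b - k * n' = k * (l * (d * b) - n') := by ring
    rw [this, abs_mul, Nat.abs_cast]
    gcongr
  have hEh : 0 < E ^ h := by positivity
  have h3 : E ^ (h + 3) = E ^ h * E ^ 3 := pow_add _ _ _
  rw [h3, mul_assoc] at h1 h2
  rcases max_choice |(k : ℝ) * l * d * a - l * n| |(k : ℝ) * l * d * b - k * n'| with hm | hm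
  · rw [hm] at this
    have := this.trans (mul_le_mul_of_nonneg_left e1 hEh.le)
    linarith
  · rw [hm] at this
    have := this.trans (mul_le_mul_of_nonneg_left e2 hEh.le)
    linarith

theorem pp_count {a b E δ : ℝ} {h R d : ℕ} (hE : 1 ≤ E) (hδ : 0 < δ)
    (H : ∀ q : ℕ, 0 < q → (q : ℝ) ≤ E ^ 9 → ∀ m m' : ℤ,
      δ ≤ E ^ h * max |q * a - m| |q * b - m'|)
    (hR : 0 < R) (hRE : (R : ℝ) ≤ E ^ 3) (hd : 0 < d) (hdE : (d : ℝ) ≤ E ^ 3)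
    (Ω : Finset (ℤ × ℤ))
    (hrow : ∀ p₁ p₂ p₃ q, (p₁, q) ∈ Ω → (p₃, q) ∈ Ω → p₁ ≤ p₂ → p₂ ≤ p₃ → (p₂, q) ∈ Ω)
    (hcol : ∀ p q₁ q₂ q₃, (p, q₁) ∈ Ω → (p, q₃) ∈ Ω → q₁ ≤ q₂ → q₂ ≤ q₃ → (p, q₂) ∈ Ω)
    (W : ℝ) (hW : ((Ω.image Prod.snd).card : ℝ) ≤ W) (hW' : ((Ω.image Prod.fst).card : ℝ) ≤ W)
    (c η : ℝ) (hη : 0 ≤ η) (hη2 : η ≤ 1 / 2) (T : Finset (ℤ × ℤ)) (hT : T ⊆ Ω)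
    (hn : ∀ v ∈ T, PPNear (c + d * (v.1 * a + v.2 * b)) η) :
    (T.card : ℝ) ≤ (2 * η + 1 / R) * Ω.card + W * (4 * E ^ (h + 6) / δ) := by
  classical
  have hR0 : (1 : ℝ) ≤ R := by exact_mod_cast hR
  have hW0 : 0 ≤ W := le_trans (Nat.cast_nonneg _) hW
  have fin : ∀ (k : ℕ) (x : ℝ), (k : ℝ) ≤ E ^ 3 → 0 ≤ x → x ≤ 1 / R → δ ≤ E ^ (h + 3) * x →
      0 < x ∧ x ≤ 1 ∧ (2 * η + x) * Ω.card + W * (4 * k / x) ≤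
        (2 * η + 1 / R) * Ω.card + W * (4 * E ^ (h + 6) / δ) := by
    intro k x hk hx0 hx1 hx2
    have hx : 0 < x := by
      rcases hx0.eq_or_lt with h0 | h0
      · rw [← h0] at hx2; linarith
      · exact h0
    refine ⟨hx, hx1.trans (by rw [div_le_one (by linarith)]; exact hR0), ?_⟩
    have : 4 * (k : ℝ) / x ≤ 4 * E ^ (h + 6) / δ := by
      rw [div_le_div_iff₀ hx hδ]
      calc 4 * (k : ℝ) * δ ≤ 4 * E ^ 3 * (E ^ (h + 3) * x) := by gcongr
        _ = _ := by ring
    gcongr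
  obtain ⟨k, hk, hkE, ⟨n, h1, h2⟩ | ⟨n, h1, h2⟩⟩ := pp_step hE H hR hRE hd hdE
  · obtain ⟨f1, f2, f3⟩ := fin k _ hkE (abs_nonneg _) h1 h2
    refine le_trans (pp_two Ω hrow W hW (d * a) (d * b) c η k hk n f1 f2 hη hη2 T hT ?_) f3
    intro v hv
    convert hn v hv using 1; ring
  · obtain ⟨f1, f2, f3⟩ := fin k _ hkE (abs_nonneg _) h1 h2
    have hsw : Function.Injective (Prod.swap : ℤ × ℤ → ℤ × ℤ) := Prod.swap_injective
    have := pp_two (Ω.image Prod.swap) ?_ W ?_ (d * b) (d * a) c η k hk n f1 f2 hη hη2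
      (T.image Prod.swap) (Finset.image_subset_image hT) ?_
    · rw [Finset.card_image_of_injective _ hsw, Finset.card_image_of_injective _ hsw] at this
      exact this.trans f3
    · intro p1 p2 p3 q g1 g2 g3 g4
      simp only [Finset.mem_image, Prod.exists, Prod.swap_prod_mk, Prod.mk.injEq] at g1 g2 ⊢
      obtain ⟨_, _, g1, rfl, rfl⟩ := g1
      obtain ⟨_, _, g2, rfl, rfl⟩ := g2
      exact ⟨_, _, hcol _ _ _ _ g1 g2 g3 g4, rfl, rfl⟩
    · rw [Finset.image_image]
      exact hW'
    · intro v hv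
      obtain ⟨w, hw, rfl⟩ := Finset.mem_image.mp hv
      convert hn w hw using 1
      simp; ring

open Classical in
def PPOm (α β C Q : ℝ) (d : ℕ) : Finset (ℤ × ℤ) :=
  ((Finset.Icc (-⌈C * Q⌉) ⌈C * Q⌉) ×ˢ (Finset.Icc 1 ⌊Q⌋)).filter
    (fun v => 19 / 20 * Q < d * v.2 ∧ d * v.2 ≤ Q ∧ α * v.2 ≤ v.1 ∧ (v.1 : ℝ) ≤ β * v.2)

theorem pp_mem_om {α β C Q : ℝ} {d : ℕ} (hQ : 0 < Q) (hd : 0 < d) (hα : |α| ≤ C) (hβ : |β| ≤ C)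
    (v : ℤ × ℤ) : v ∈ PPOm α β C Q d ↔
      (19 / 20 * Q < d * v.2 ∧ d * v.2 ≤ Q ∧ α * v.2 ≤ v.1 ∧ (v.1 : ℝ) ≤ β * v.2) := by
  unfold PPOm
  rw [Finset.mem_filter, and_iff_right_iff_imp]
  rintro ⟨h1, h2, h3, h4⟩
  have hd1 : (1 : ℝ) ≤ d := by exact_mod_cast hd
  have hv : (0 : ℝ) < v.2 := by
    by_contra hc
    push Not at hc
    nlinarith
  have hvQ : (v.2 : ℝ) ≤ Q := by nlinarith
  have hC : 0 ≤ C := (abs_nonneg _).trans hα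
  rw [abs_le] at hα hβ
  rw [Finset.mem_product, Finset.mem_Icc, Finset.mem_Icc]
  refine ⟨⟨?_, ?_⟩, ?_, ?_⟩
  · have : -(v.1 : ℝ) ≤ ⌈C * Q⌉ := le_trans (by nlinarith) (Int.le_ceil _)
    have : -v.1 ≤ ⌈C * Q⌉ := by exact_mod_cast this
    linarith
  · have : (v.1 : ℝ) ≤ ⌈C * Q⌉ := le_trans (by nlinarith) (Int.le_ceil _)
    exact_mod_cast this
  · have : 0 < v.2 := by exact_mod_cast hv
    linarith
  · exact Int.le_floor.mpr hvQ

theorem pp_om_row {α β C Q : ℝ} {d : ℕ} (hQ : 0 < Q) (hd : 0 < d) (hα : |α| ≤ C) (hβ : |β| ≤ C) :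
    ∀ p₁ p₂ p₃ q, (p₁, q) ∈ PPOm α β C Q d → (p₃, q) ∈ PPOm α β C Q d → p₁ ≤ p₂ → p₂ ≤ p₃ →
      (p₂, q) ∈ PPOm α β C Q d := by
  intro p₁ p₂ p₃ q
  simp only [pp_mem_om hQ hd hα hβ]
  rintro ⟨h1, h2, h3, h4⟩ ⟨h5, h6, h7, h8⟩ h9 h10
  have h9 : (p₁ : ℝ) ≤ p₂ := by exact_mod_cast h9
  have h10 : (p₂ : ℝ) ≤ p₃ := by exact_mod_cast h10
  exact ⟨h1, h2, by linarith, by linarith⟩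

theorem pp_conv {α p x y z : ℝ} (hxy : x ≤ y) (hyz : y ≤ z) (h1 : α * x ≤ p) (h2 : α * z ≤ p) :
    α * y ≤ p := by
  rcases le_total 0 α with h | h <;> nlinarith

theorem pp_om_col {α β C Q : ℝ} {d : ℕ} (hQ : 0 < Q) (hd : 0 < d) (hα : |α| ≤ C) (hβ : |β| ≤ C) :
    ∀ p q₁ q₂ q₃, (p, q₁) ∈ PPOm α β C Q d → (p, q₃) ∈ PPOm α β C Q d → q₁ ≤ q₂ → q₂ ≤ q₃ →
      (p, q₂) ∈ PPOm α β C Q d := by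
  intro p q₁ q₂ q₃
  simp only [pp_mem_om hQ hd hα hβ]
  rintro ⟨h1, h2, h3, h4⟩ ⟨h5, h6, h7, h8⟩ h9 h10
  have h9 : (q₁ : ℝ) ≤ q₂ := by exact_mod_cast h9
  have h10 : (q₂ : ℝ) ≤ q₃ := by exact_mod_cast h10
  refine ⟨?_, ?_, pp_conv h9 h10 h3 h7, ?_⟩
  · have : (d : ℝ) * q₁ ≤ d * q₂ := by gcongr
    linarith
  · have : (d : ℝ) * q₂ ≤ d * q₃ := by gcongr
    linarith
  · have := @pp_conv (-β) (-p) q₁ q₂ q₃ h9 h10 (by linarith) (by linarith)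
    linarith

theorem pp_om_snd {α β C Q : ℝ} {d : ℕ} (hQ : 1 ≤ Q) (hC : 1 ≤ C) (hd : 0 < d) (hα : |α| ≤ C) (hβ : |β| ≤ C) :
    (((PPOm α β C Q d).image Prod.snd).card : ℝ) ≤ Q / 20 / d + 1 ∧
    (((PPOm α β C Q d).image Prod.snd).card : ℝ) ≤ 3 * C * Q := by
  have hd1 : (1 : ℝ) ≤ d := by exact_mod_cast hd
  have h1 : (((PPOm α β C Q d).image Prod.snd).card : ℝ) ≤ Q / 20 / d + 1 := by
    apply pp_sepInt _ (19 / 20 * Q / d)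
    · positivity
    · intro x hx
      obtain ⟨v, hv, rfl⟩ := Finset.mem_image.mp hx
      rw [pp_mem_om (by linarith) hd hα hβ] at hv
      rw [div_le_iff₀ (by linarith)]; linarith
    · intro x hx
      obtain ⟨v, hv, rfl⟩ := Finset.mem_image.mp hx
      rw [pp_mem_om (by linarith) hd hα hβ] at hv
      rw [← add_div, le_div_iff₀ (by linarith)]; linarith
  refine ⟨h1, h1.trans ?_⟩
  have : Q / 20 / d ≤ Q / 20 := div_le_self (by linarith) hd1
  nlinarith

theorem pp_om_fst {α β C Q : ℝ} {d : ℕ} (hQ : 1 ≤ Q) (hC : 1 ≤ C) (hd : 0 < d) (hα : |α| ≤ C) (hβ : |β| ≤ C) :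
    (((PPOm α β C Q d).image Prod.fst).card : ℝ) ≤ 3 * C * Q := by
  have hd1 : (1 : ℝ) ≤ d := by exact_mod_cast hd
  have h1 : (((PPOm α β C Q d).image Prod.fst).card : ℝ) ≤ 2 * (C * Q) + 1 := by
    rw [abs_le] at hα hβ
    apply pp_sepInt _ (-(C * Q))
    · positivity
    · intro x hx
      obtain ⟨v, hv, rfl⟩ := Finset.mem_image.mp hx
      rw [pp_mem_om (by linarith) hd (abs_le.mpr hα) (abs_le.mpr hβ)] at hv
      have hv0 : (0 : ℝ) < v.2 := by
        by_contra hc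
        push Not at hc
        nlinarith
      have hvQ : (v.2 : ℝ) ≤ Q := by nlinarith
      have hCQ : C * v.2 ≤ C * Q := by gcongr
      nlinarith
    · intro x hx
      obtain ⟨v, hv, rfl⟩ := Finset.mem_image.mp hx
      rw [pp_mem_om (by linarith) hd (abs_le.mpr hα) (abs_le.mpr hβ)] at hv
      have hv0 : (0 : ℝ) < v.2 := by
        by_contra hc
        push Not at hc
        nlinarith
      have hvQ : (v.2 : ℝ) ≤ Q := by nlinarith
      have hCQ : C * v.2 ≤ C * Q := by gcongr
      nlinarith
  nlinarith

theorem pp_om_upper {α β C Q : ℝ} {d : ℕ} (hαβ : α ≤ β) (hQ : 1 ≤ Q) (hC : 1 ≤ C) (hd : 0 < d)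
    (hα : |α| ≤ C) (hβ : |β| ≤ C) :
    ((PPOm α β C Q d).card : ℝ) ≤ (Q / 20 / d + 1) * ((β - α) * (Q / d) + 1) := by
  have hd1 : (1 : ℝ) ≤ d := by exact_mod_cast hd
  have hg : 0 ≤ β - α := by linarith
  apply pp_fib _ Prod.snd _ _ (by positivity) (pp_om_snd hQ hC hd hα hβ).1
  intro q _
  have hi : Set.InjOn Prod.fst (((PPOm α β C Q d).filter (fun v => v.2 = q) : Finset (ℤ × ℤ)) : Set (ℤ × ℤ)) := by
    intro x hx y hy hxy
    simp only [Finset.coe_filter, Set.mem_ofPred_eq] at hx hy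
    exact Prod.ext hxy (hx.2.trans hy.2.symm)
  rw [← Finset.card_image_of_injOn hi]
  apply pp_sepInt _ (α * q)
  · positivity
  · intro x hx
    obtain ⟨v, hv', rfl⟩ := Finset.mem_image.mp hx
    have hv := (Finset.mem_filter.mp hv')
    obtain ⟨hv, rfl⟩ := hv
    rw [pp_mem_om (by linarith) hd hα hβ] at hv
    linarith
  · intro x hx
    obtain ⟨v, hv', rfl⟩ := Finset.mem_image.mp hx
    have hv := (Finset.mem_filter.mp hv')
    obtain ⟨hv, rfl⟩ := hv
    rw [pp_mem_om (by linarith) hd hα hβ] at hv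
    have : (v.2 : ℝ) ≤ Q / d := by
      rw [le_div_iff₀ (by linarith)]; linarith
    nlinarith

theorem pp_om_lower {α β C Q : ℝ} (hαβ : α ≤ β) (hQ : 20 ≤ Q)
    (hQ2 : 1 ≤ (β - α) * (19 / 20 * Q))
    (hα : |α| ≤ C) (hβ : |β| ≤ C) :
    (Q / 20 - 1) * ((β - α) * (19 / 20 * Q) - 1) ≤ ((PPOm α β C Q 1).card : ℝ) := by
  classical
  set I := Finset.Icc (⌊19 / 20 * Q⌋ + 1) ⌊Q⌋
  have hIm : ∀ q ∈ I, 19 / 20 * Q < (q : ℝ) ∧ (q : ℝ) ≤ Q := by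
    intro q hq
    rw [Finset.mem_Icc] at hq
    exact ⟨Int.floor_lt.mp (by omega), Int.le_floor.mp hq.2⟩
  have hI : Q / 20 - 1 ≤ (I.card : ℝ) := by
    have h1 : (⌊Q⌋ + 1 - (⌊19 / 20 * Q⌋ + 1)) ≤ (I.card : ℤ) := by
      rw [Int.card_Icc]; omega
    have h2 : ((⌊Q⌋ + 1 - (⌊19 / 20 * Q⌋ + 1) : ℤ) : ℝ) ≤ (I.card : ℝ) := by exact_mod_cast h1
    push_cast at h2
    have := Int.floor_le (19 / 20 * Q)
    have := Int.lt_floor_add_one Q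
    linarith
  have hsub : (I.sigma (fun q => Finset.Icc ⌈α * q⌉ ⌊β * q⌋)).card ≤ (PPOm α β C Q 1).card := by
    apply Finset.card_le_card_of_injOn (fun x => (x.2, x.1))
    · intro x hx
      simp only [Finset.coe_sigma] at hx
      obtain ⟨h1, h2⟩ := Set.mem_sigma_iff.mp hx
      have h3 := hIm _ h1
      have h2 := Finset.mem_Icc.mp h2
      refine (pp_mem_om (by linarith) one_pos hα hβ _).mpr ?_
      have h4 := Int.ceil_le.mp h2.1
      have h5 := Int.le_floor.mp h2.2
      simp only [Nat.cast_one, one_mul]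
      exact ⟨h3.1, h3.2, h4, h5⟩
    · rintro ⟨x, x'⟩ _ ⟨y, y'⟩ _ hxy
      simp only [Prod.mk.injEq] at hxy
      rw [hxy.1, hxy.2]
  rw [Finset.card_sigma] at hsub
  have hsub' : ((∑ q ∈ I, (Finset.Icc ⌈α * q⌉ ⌊β * q⌋).card : ℕ) : ℝ) ≤ (PPOm α β C Q 1).card := by
    exact_mod_cast hsub
  refine le_trans ?_ hsub'
  push_cast
  calc (Q / 20 - 1) * ((β - α) * (19 / 20 * Q) - 1)
      ≤ I.card * ((β - α) * (19 / 20 * Q) - 1) := by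
        apply mul_le_mul_of_nonneg_right hI; linarith
    _ = ∑ q ∈ I, ((β - α) * (19 / 20 * Q) - 1) := by rw [Finset.sum_const, nsmul_eq_mul]
    _ ≤ _ := by
        apply Finset.sum_le_sum
        intro q hq
        have h1 : (⌊β * q⌋ + 1 - ⌈α * q⌉ : ℤ) ≤ ((Finset.Icc ⌈α * q⌉ ⌊β * q⌋).card : ℤ) := by
          rw [Int.card_Icc]; omega
        have h2 : ((⌊β * q⌋ + 1 - ⌈α * q⌉ : ℤ) : ℝ) ≤ (Finset.Icc ⌈α * q⌉ ⌊β * q⌋).card := by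
          exact_mod_cast h1
        push_cast at h2
        have := Int.lt_floor_add_one (β * q)
        have := Int.ceil_lt_add_one (α * q)
        have := hIm q hq
        nlinarith

open Classical in
theorem pp_np (a b : ℝ) {α β C Q η : ℝ} (hQ : 1 ≤ Q) (hα : |α| ≤ C) (hβ : |β| ≤ C) :
    (((PPOm α β C Q 1).filter (fun v => PPNear (v.1 * a + v.2 * b) η ∧ Int.gcd v.1 v.2 ≠ 1)).card : ℝ)
      ≤ ∑ d ∈ Finset.Ioc 1 ⌊Q⌋₊,
        (((PPOm α β C Q d).filter (fun v => PPNear (d * (v.1 * a + v.2 * b)) η)).card : ℝ) := by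
  have hQ0 : 0 < Q := by linarith
  have hsub : (PPOm α β C Q 1).filter (fun v => PPNear (v.1 * a + v.2 * b) η ∧ Int.gcd v.1 v.2 ≠ 1) ⊆
      (Finset.Ioc 1 ⌊Q⌋₊).biUnion (fun d =>
        ((PPOm α β C Q d).filter (fun v => PPNear (d * (v.1 * a + v.2 * b)) η)).image
          (fun v => ((d : ℤ) * v.1, (d : ℤ) * v.2))) := by
    intro v hv
    obtain ⟨hv1, hv2, hv3⟩ := Finset.mem_filter.mp hv
    rw [pp_mem_om hQ0 one_pos hα hβ] at hv1
    simp only [Nat.cast_one, one_mul] at hv1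
    obtain ⟨h1, h2, h3, h4⟩ := hv1
    have hpos : (0 : ℝ) < v.2 := by linarith
    have hposZ : 0 < v.2 := by exact_mod_cast hpos
    set g := Int.gcd v.1 v.2 with hg
    have hg0 : 0 < g := Int.gcd_pos_of_ne_zero_right _ hposZ.ne'
    obtain ⟨x, hx⟩ : (g : ℤ) ∣ v.1 := Int.gcd_dvd_left _ _
    obtain ⟨y, hy⟩ : (g : ℤ) ∣ v.2 := Int.gcd_dvd_right _ _
    have hgR : (0 : ℝ) < g := by exact_mod_cast hg0
    have hxR : (v.1 : ℝ) = g * x := by rw [hx]; push_cast; ring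
    have hyR : (v.2 : ℝ) = g * y := by rw [hy]; push_cast; ring
    rw [Finset.mem_biUnion]
    refine ⟨g, ?_, ?_⟩
    · rw [Finset.mem_Ioc]
      refine ⟨by omega, Nat.le_floor ?_⟩
      have : (g : ℤ) ≤ v.2 := Int.le_of_dvd hposZ (Int.gcd_dvd_right _ _)
      have : (g : ℝ) ≤ v.2 := by exact_mod_cast this
      linarith
    · rw [Finset.mem_image]
      refine ⟨(x, y), ?_, Prod.ext hx.symm hy.symm⟩
      rw [Finset.mem_filter, pp_mem_om hQ0 hg0 hα hβ]
      simp only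
      refine ⟨⟨by rw [← hyR]; exact h1, by rw [← hyR]; exact h2, ?_, ?_⟩, ?_⟩
      · rw [hxR, hyR] at h3
        have : (g : ℝ) * (α * y) ≤ g * x := by linarith
        exact le_of_mul_le_mul_left this hgR
      · rw [hxR, hyR] at h4
        have : (g : ℝ) * x ≤ g * (β * y) := by linarith
        exact le_of_mul_le_mul_left this hgR
      · rw [hxR, hyR] at hv2
        convert hv2 using 1; ring
  have h1 := (Finset.card_le_card hsub).trans Finset.card_biUnion_le
  have h2 : ∀ d ∈ Finset.Ioc 1 ⌊Q⌋₊, (((PPOm α β C Q d).filter (fun v => PPNear (d * (v.1 * a + v.2 * b)) η)).image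
          (fun v => ((d : ℤ) * v.1, (d : ℤ) * v.2))).card ≤
          ((PPOm α β C Q d).filter (fun v => PPNear (d * (v.1 * a + v.2 * b)) η)).card :=
    fun d _ => Finset.card_image_le
  exact_mod_cast h1.trans (Finset.sum_le_sum h2)

theorem pp_prod_bound {Q γ d : ℝ} (hQ : 1 ≤ Q) (hγ : 0 ≤ γ) (hd : 0 < d) :
    (Q / 20 / d + 1) * (γ * (Q / d) + 1) = γ * Q ^ 2 / 20 * (d ^ 2)⁻¹ + (1 / 20 + γ) * (Q / d) + 1 := by
  field_simp
  ring

set_option maxHeartbeats 1000000 in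
open Classical in
theorem pp_np2 {a b E δ : ℝ} {h R : ℕ} (hE : 2 ≤ E) (hδ : 0 < δ)
    (H : ∀ q : ℕ, 0 < q → (q : ℝ) ≤ E ^ 9 → ∀ m m' : ℤ,
      δ ≤ E ^ h * max |q * a - m| |q * b - m'|)
    {α β C Q η : ℝ} (hαβ : α ≤ β) (hC : 1 ≤ C) (hα : |α| ≤ C) (hβ : |β| ≤ C)
    (hη : 0 < η) (hη2 : η ≤ 1 / 4)
    (hR : 100 / η ≤ R) (hRE : (R : ℝ) ≤ E ^ 3) (hQE : E ^ (h + 15) ≤ Q) :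
    (((PPOm α β C Q 1).filter (fun v => PPNear (v.1 * a + v.2 * b) η ∧ Int.gcd v.1 v.2 ≠ 1)).card : ℝ)
      ≤ 0.0755 * ((β - α) * η * Q ^ 2) +
        (3 + 3 * (β - α) + 12 * C / δ) * (Q ^ 2 / E ^ 3) := by
  have hE1 : 1 ≤ E := by linarith
  have hEp : ∀ n : ℕ, 1 ≤ E ^ n := fun n => one_le_pow₀ hE1
  have hQ : 1 ≤ Q := (hEp _).trans hQE
  set γ := β - α with hγ
  have hγ0 : 0 ≤ γ := by linarith
  set Y := Q ^ 2 / E ^ 3 with hY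
  have hE3 : 0 < E ^ 3 := by positivity
  have hYQ : Q * E ^ (h + 9) ≤ Y := by
    rw [hY, le_div_iff₀ hE3]
    calc Q * E ^ (h + 9) * E ^ 3 = Q * E ^ (h + 12) := by ring
      _ ≤ Q * E ^ (h + 15) := by gcongr <;> omega
      _ ≤ Q * Q := by gcongr
      _ = Q ^ 2 := by ring
  have hYQ3 : Q * E ^ 3 ≤ Y := le_trans (by gcongr <;> omega) hYQ
  have hYQ1 : Q ≤ Y := le_trans (by nlinarith [hEp 3]) hYQ3
  have hY0 : 0 < Y := by positivity
  have hR1 : 1 / (R : ℝ) ≤ η / 100 := by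
    have : 0 < 100 / η := by positivity
    have h0 : (0 : ℝ) < R := by linarith
    rw [div_le_div_iff₀ h0 (by norm_num)]
    rw [div_le_iff₀ hη] at hR
    linarith
  have hR0 : 0 < R := by
    have : 0 < 100 / η := by positivity
    have h0 : (0 : ℝ) < R := by linarith
    exact_mod_cast h0
  set D := ⌊E ^ 3⌋₊ with hD
  have hDE : (D : ℝ) ≤ E ^ 3 := Nat.floor_le hE3.le
  have hDE2 : E ^ 3 < D + 1 := Nat.lt_floor_add_one _
  have hE8 : 8 ≤ E ^ 3 := by nlinarith [sq_nonneg (E - 2), mul_pos (show 0 < E by linarith) (show 0 < E by linarith)]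
  have hD2 : 2 ≤ D := Nat.le_floor (by push_cast; linarith)
  have hDQ : D ≤ ⌊Q⌋₊ := Nat.floor_le_floor (le_trans (by gcongr <;> omega) hQE)
  set err := 3 * C * Q * (4 * E ^ (h + 6) / δ) with herr
  have herr0 : 0 ≤ err := by positivity
  have herrY : E ^ 3 * err ≤ 12 * C / δ * Y := by
    calc E ^ 3 * err = 12 * C / δ * (Q * E ^ (h + 9)) := by rw [herr]; ring
      _ ≤ _ := by gcongr
  -- bound for each d
  have hcard : ∀ d : ℕ, 0 < d → ((PPOm α β C Q d).card : ℝ) ≤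
      γ * Q ^ 2 / 20 * ((d : ℝ) ^ 2)⁻¹ + (1 / 20 + γ) * (Q / d) + 1 := by
    intro d hd
    rw [← pp_prod_bound hQ hγ0 (by exact_mod_cast hd)]
    exact pp_om_upper hαβ hQ hC hd hα hβ
  have hsmall : ∀ d ∈ Finset.Ioc 1 D,
      (((PPOm α β C Q d).filter (fun v => PPNear (d * (v.1 * a + v.2 * b)) η)).card : ℝ) ≤
      2.01 * η * (γ * Q ^ 2 / 20) * ((d : ℝ) ^ 2)⁻¹ + ((1 + γ) * Q + err) := by
    intro d hd
    rw [Finset.mem_Ioc] at hd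
    have hd0 : 0 < d := by omega
    have hd1 : (1 : ℝ) ≤ d := by exact_mod_cast hd0
    have h1 := pp_count (a := a) (b := b) (d := d) hE1 hδ H hR0 hRE hd0
      (le_trans (by exact_mod_cast hd.2) hDE) (PPOm α β C Q d)
      (pp_om_row (by linarith) hd0 hα hβ) (pp_om_col (by linarith) hd0 hα hβ) (3 * C * Q)
      (pp_om_snd hQ hC hd0 hα hβ).2 (pp_om_fst hQ hC hd0 hα hβ) 0 η hη.le (by linarith)
      ((PPOm α β C Q d).filter (fun v => PPNear (d * (v.1 * a + v.2 * b)) η))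
      (Finset.filter_subset _ _) (by
        intro v hv
        have := (Finset.mem_filter.mp hv).2
        convert this using 1; ring)
    refine h1.trans ?_
    rw [← herr]
    have h2 : (2 * η + 1 / R) * ((PPOm α β C Q d).card : ℝ) ≤
        2.01 * η * (γ * Q ^ 2 / 20 * ((d : ℝ) ^ 2)⁻¹ + (1 / 20 + γ) * (Q / d) + 1) := by
      apply mul_le_mul _ (hcard d hd0) (by positivity) (by positivity)
      linarith
    have h3 : 2.01 * η * ((1 / 20 + γ) * (Q / d) + 1) ≤ (1 + γ) * Q := by
      have h4 : Q / d ≤ Q := div_le_self (by linarith) hd1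
      calc 2.01 * η * ((1 / 20 + γ) * (Q / d) + 1) ≤ 2.01 * (1 / 4) * ((1 / 20 + γ) * Q + 1) := by gcongr
        _ ≤ _ := by nlinarith
    linarith
  have hlarge : ∀ d ∈ Finset.Ioc D ⌊Q⌋₊,
      (((PPOm α β C Q d).filter (fun v => PPNear (d * (v.1 * a + v.2 * b)) η)).card : ℝ) ≤
      (γ * Q ^ 2 / 20) * ((d : ℝ) ^ 2)⁻¹ + ((1 / 20 + γ) * (Q / E ^ 3) + 1) := by
    intro d hd
    rw [Finset.mem_Ioc] at hd
    have hd0 : 0 < d := by omega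
    have hdE : E ^ 3 ≤ d := by
      have : (D : ℝ) + 1 ≤ d := by exact_mod_cast hd.1
      linarith
    have h1 : (((PPOm α β C Q d).filter (fun v => PPNear (d * (v.1 * a + v.2 * b)) η)).card : ℝ) ≤
      (PPOm α β C Q d).card := by exact_mod_cast Finset.card_le_card (Finset.filter_subset _ _)
    have h2 : (1 / 20 + γ) * (Q / d) ≤ (1 / 20 + γ) * (Q / E ^ 3) := by gcongr
    linarith [hcard d hd0]
  refine (pp_np a b hQ hα hβ).trans ?_
  have hsplit : Finset.Ioc 1 ⌊Q⌋₊ = Finset.Ioc 1 D ∪ Finset.Ioc D ⌊Q⌋₊ := by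
    rw [Finset.Ioc_union_Ioc_eq_Ioc (by omega) hDQ]
  have hdisj : Disjoint (Finset.Ioc 1 D) (Finset.Ioc D ⌊Q⌋₊) := Finset.Ioc_disjoint_Ioc_of_le le_rfl
  rw [hsplit, Finset.sum_union hdisj]
  have s1 := Finset.sum_le_sum hsmall
  have s2 := Finset.sum_le_sum hlarge
  rw [Finset.sum_add_distrib, ← Finset.mul_sum, Finset.sum_const, nsmul_eq_mul] at s1 s2
  have i1 : ∑ d ∈ Finset.Ioc 1 D, ((d : ℝ) ^ 2)⁻¹ ≤ 3 / 4 := by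
    have e : Finset.Ioc 1 D = Finset.Ioc 1 2 ∪ Finset.Ioc 2 D := by
      rw [Finset.Ioc_union_Ioc_eq_Ioc (by omega) hD2]
    have e2 : Finset.Ioc 1 2 = {2} := by decide
    rw [e, Finset.sum_union (Finset.Ioc_disjoint_Ioc_of_le le_rfl), e2, Finset.sum_singleton]
    have h1 := sum_Ioc_inv_sq_le_sub (α := ℝ) (k := 2) (n := D) (by norm_num) hD2
    have h2 : (0 : ℝ) ≤ (D : ℝ)⁻¹ := by positivity
    norm_num at h1 ⊢
    linarith
  have i2 : ∑ d ∈ Finset.Ioc D ⌊Q⌋₊, ((d : ℝ) ^ 2)⁻¹ ≤ 2 / E ^ 3 := by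
    have h1 := sum_Ioc_inv_sq_le_sub (α := ℝ) (k := D) (n := ⌊Q⌋₊) (by omega) hDQ
    have h2 : (0 : ℝ) ≤ ((⌊Q⌋₊ : ℕ) : ℝ)⁻¹ := by positivity
    have h3 : (D : ℝ)⁻¹ ≤ 2 / E ^ 3 := by
      have : (2 : ℝ) ≤ D := by exact_mod_cast hD2
      rw [inv_eq_one_div, div_le_div_iff₀ (by linarith) hE3]
      linarith
    linarith
  have c1 : ((Finset.Ioc 1 D).card : ℝ) ≤ E ^ 3 := by
    rw [Nat.card_Ioc]
    refine le_trans ?_ hDE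
    exact_mod_cast Nat.sub_le _ _
  have c2 : ((Finset.Ioc D ⌊Q⌋₊).card : ℝ) ≤ Q := by
    rw [Nat.card_Ioc]
    refine le_trans ?_ (Nat.floor_le (by linarith : 0 ≤ Q))
    exact_mod_cast Nat.sub_le _ _
  have t1 : 2.01 * η * (γ * Q ^ 2 / 20) * ∑ d ∈ Finset.Ioc 1 D, ((d : ℝ) ^ 2)⁻¹ ≤
      2.01 * η * (γ * Q ^ 2 / 20) * (3 / 4) := by gcongr
  have t2 : (γ * Q ^ 2 / 20) * ∑ d ∈ Finset.Ioc D ⌊Q⌋₊, ((d : ℝ) ^ 2)⁻¹ ≤ γ / 10 * Y := by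
    calc _ ≤ (γ * Q ^ 2 / 20) * (2 / E ^ 3) := by gcongr
      _ = _ := by rw [hY]; ring
  have t3 : ((Finset.Ioc 1 D).card : ℝ) * ((1 + γ) * Q + err) ≤ (1 + γ) * Y + 12 * C / δ * Y := by
    calc _ ≤ E ^ 3 * ((1 + γ) * Q + err) := by gcongr
      _ = (1 + γ) * (Q * E ^ 3) + E ^ 3 * err := by ring
      _ ≤ _ := by gcongr
  have t4 : ((Finset.Ioc D ⌊Q⌋₊).card : ℝ) * ((1 / 20 + γ) * (Q / E ^ 3) + 1) ≤ (1 / 20 + γ) * Y + Y := by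
    calc _ ≤ Q * ((1 / 20 + γ) * (Q / E ^ 3) + 1) := by gcongr
      _ = (1 / 20 + γ) * Y + Q := by rw [hY]; ring
      _ ≤ _ := by gcongr
  have u1 : 0 ≤ γ * Y := by positivity
  have u2 : 0 ≤ γ * η * Q ^ 2 := by positivity
  linarith

open Classical in
theorem pp_prim {a b E δ : ℝ} {h R : ℕ} (hE : 2 ≤ E) (hδ : 0 < δ)
    (H : ∀ q : ℕ, 0 < q → (q : ℝ) ≤ E ^ 9 → ∀ m m' : ℤ,
      δ ≤ E ^ h * max |q * a - m| |q * b - m'|)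
    {α β C Q η : ℝ} (hαβ : α < β) (hC : 1 ≤ C) (hα : |α| ≤ C) (hβ : |β| ≤ C)
    (hη : 0 < η) (hη2 : η ≤ 1 / 4)
    (hR : 100 / η ≤ R) (hRE : (R : ℝ) ≤ E ^ 3) (hQE : E ^ (h + 15) ≤ Q)
    (hEγ : 2 / (β - α) ≤ E) :
    0.0185 * ((β - α) * η * Q ^ 2) -
        (4 + 4 * (β - α) + 24 * C / δ) * (Q ^ 2 / E ^ 3) ≤
    (((PPOm α β C Q 1).filter (fun v => PPNear (v.1 * a + v.2 * b) η ∧ Int.gcd v.1 v.2 = 1)).card : ℝ) := by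
  have hnp := pp_np2 hE hδ H hαβ.le hC hα hβ hη hη2 hR hRE hQE
  have hE1 : 1 ≤ E := by linarith
  have hEp : ∀ n : ℕ, 1 ≤ E ^ n := fun n => one_le_pow₀ hE1
  have hQ : 1 ≤ Q := (hEp _).trans hQE
  have hEQ : E ^ 15 ≤ Q := le_trans (by gcongr <;> omega) hQE
  have hEQ1 : E ≤ Q := le_trans (by calc E = E ^ 1 := by ring
                                     _ ≤ E ^ 15 := by gcongr; norm_num) hEQ
  have hQ20 : 20 ≤ Q := by
    have : (2 : ℝ) ^ 15 ≤ E ^ 15 := by gcongr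
    norm_num at this
    linarith
  set γ := β - α with hγ
  have hγ0 : 0 < γ := by linarith
  set Y := Q ^ 2 / E ^ 3 with hY
  have hE3 : 0 < E ^ 3 := by positivity
  have hYQ : Q * E ^ (h + 9) ≤ Y := by
    rw [hY, le_div_iff₀ hE3]
    calc Q * E ^ (h + 9) * E ^ 3 = Q * E ^ (h + 12) := by ring
      _ ≤ Q * E ^ (h + 15) := by gcongr <;> omega
      _ ≤ Q * Q := by gcongr
      _ = Q ^ 2 := by ring
  have hYQ1 : Q ≤ Y := le_trans (by nlinarith [hEp (h + 9)]) hYQ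
  have hY0 : 0 < Y := by positivity
  have hR0' : (0 : ℝ) < R := by
    have : 0 < 100 / η := by positivity
    linarith
  have hR1 : 1 / (R : ℝ) ≤ η / 100 := by
    rw [div_le_div_iff₀ hR0' (by norm_num)]
    rw [div_le_iff₀ hη] at hR
    linarith
  have hR0 : 0 < R := by exact_mod_cast hR0'
  set err := 3 * C * Q * (4 * E ^ (h + 6) / δ) with herr
  have herrY : err ≤ 12 * C / δ * Y := by
    calc err = 12 * C / δ * (Q * E ^ (h + 6)) := by rw [herr]; ring
      _ ≤ 12 * C / δ * (Q * E ^ (h + 9)) := by gcongr <;> omega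
      _ ≤ _ := by gcongr
  set Ω := PPOm α β C Q 1 with hΩ
  have hlow : (Q / 20 - 1) * (γ * (19 / 20 * Q) - 1) ≤ (Ω.card : ℝ) := by
    apply pp_om_lower hαβ.le hQ20 _ hα hβ
    rw [div_le_iff₀ hγ0] at hEγ
    rw [← hγ]
    nlinarith
  have hbad := pp_count (a := a) (b := b) (d := 1) hE1 hδ H hR0 hRE one_pos
      (by simpa using hEp 3) Ω
      (pp_om_row (by linarith) one_pos hα hβ) (pp_om_col (by linarith) one_pos hα hβ) (3 * C * Q)
      (pp_om_snd hQ hC one_pos hα hβ).2 (pp_om_fst hQ hC one_pos hα hβ) (1 / 2) (1 / 2 - η) (by linarith)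
      (by linarith) (Ω.filter (fun v => ¬ PPNear (v.1 * a + v.2 * b) η)) (Finset.filter_subset _ _) (by
        intro v hv
        have := pp_near_compl (Finset.mem_filter.mp hv).2
        convert this using 1; push_cast; ring)
  rw [← herr] at hbad
  have hsum : (Ω.filter (fun v => PPNear (v.1 * a + v.2 * b) η ∧ Int.gcd v.1 v.2 = 1)).card +
      (Ω.filter (fun v => PPNear (v.1 * a + v.2 * b) η ∧ Int.gcd v.1 v.2 ≠ 1)).card +
      (Ω.filter (fun v => ¬ PPNear (v.1 * a + v.2 * b) η)).card = Ω.card := by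
    rw [← Finset.card_filter_add_card_filter_not (s := Ω) (fun v => PPNear (v.1 * a + v.2 * b) η)]
    congr 1
    rw [← Finset.card_filter_add_card_filter_not
      (s := Ω.filter (fun v => PPNear (v.1 * a + v.2 * b) η)) (fun v => Int.gcd v.1 v.2 = 1),
      Finset.filter_filter, Finset.filter_filter]
  have hsumR : ((Ω.filter (fun v => PPNear (v.1 * a + v.2 * b) η ∧ Int.gcd v.1 v.2 = 1)).card : ℝ) +
      (Ω.filter (fun v => PPNear (v.1 * a + v.2 * b) η ∧ Int.gcd v.1 v.2 ≠ 1)).card +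
      (Ω.filter (fun v => ¬ PPNear (v.1 * a + v.2 * b) η)).card = Ω.card := by exact_mod_cast hsum
  have h1 : (2 * η - 1 / R) * (Ω.card : ℝ) - err ≤
      Ω.card - (Ω.filter (fun v => ¬ PPNear (v.1 * a + v.2 * b) η)).card := by linarith
  have h2 : 1.99 * η * ((Q / 20 - 1) * (γ * (19 / 20 * Q) - 1)) ≤ (2 * η - 1 / R) * (Ω.card : ℝ) := by
    calc _ ≤ 1.99 * η * (Ω.card : ℝ) := by gcongr
      _ ≤ _ := by gcongr; linarith
  have h3 : 0.0945 * (γ * η * Q ^ 2) - (1 + γ) * Y ≤ 1.99 * η * ((Q / 20 - 1) * (γ * (19 / 20 * Q) - 1)) := by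
    have e : 1.99 * η * ((Q / 20 - 1) * (γ * (19 / 20 * Q) - 1)) =
      1.99 * 19 / 400 * (γ * η * Q ^ 2) - 1.99 * η * (1 / 20 + 19 / 20 * γ) * Q + 1.99 * η := by ring
    rw [e]
    have e2 : 1.99 * η * (1 / 20 + 19 / 20 * γ) * Q ≤ (1 + γ) * Y := by
      calc 1.99 * η * (1 / 20 + 19 / 20 * γ) * Q ≤ 1.99 * (1 / 4) * (1 / 20 + 19 / 20 * γ) * Y := by gcongr
        _ ≤ (1 + γ) * Y := by gcongr; linarith
    have : 0 ≤ γ * η * Q ^ 2 := by positivity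
    linarith
  have e24 : 24 * C / δ * Y = 12 * C / δ * Y + 12 * C / δ * Y := by ring
  have : 0 ≤ γ * η * Q ^ 2 := by positivity
  linarith

theorem pp_wit {a b η Q : ℝ} {p q p' q' m m' : ℤ} (hq0 : 0 < q) (hq0' : 0 < q')
    (hq : (q : ℝ) ≤ Q) (hq' : (q' : ℝ) ≤ Q)
    (hm : |p * a + q * b - m| ≤ η) (hm' : |p' * a + q' * b - m'| ≤ η)
    (hD : p * q' - p' * q ≠ 0) :
    ∃ (k : ℕ) (l l' : ℤ), 0 < k ∧ (k : ℤ) ≤ |p * q' - p' * q| ∧ |(l : ℝ) - a * k| ≤ 2 * η * Q ∧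
      (k : ℤ) * m = l * p + l' * q ∧ ∃ u v w : ℤ, k * u + l * v + l' * w = 1 := by
  obtain ⟨D, hDd⟩ : ∃ D, D = p * q' - p' * q := ⟨_, rfl⟩
  obtain ⟨l0, hl0⟩ : ∃ l0, l0 = m * q' - m' * q := ⟨_, rfl⟩
  obtain ⟨l1, hl1⟩ : ∃ l1, l1 = p * m' - p' * m := ⟨_, rfl⟩
  rw [← hDd] at hD ⊢
  have hrel : D * m = l0 * p + l1 * q := by rw [hDd, hl0, hl1]; ring
  have hη : 0 ≤ η := (abs_nonneg _).trans hm
  have hb : |(l0 : ℝ) - a * D| ≤ 2 * η * Q := by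
    have e : (l0 : ℝ) - a * D = (p' * a + q' * b - m') * q - (p * a + q * b - m) * q' := by
      rw [hl0, hDd]; push_cast; ring
    rw [e]
    have hqR : (0 : ℝ) < q := by exact_mod_cast hq0
    have hqR' : (0 : ℝ) < q' := by exact_mod_cast hq0'
    calc _ ≤ |(p' * a + q' * b - m') * q| + |(p * a + q * b - m) * q'| := abs_sub _ _
      _ ≤ η * Q + η * Q := by
          rw [abs_mul, abs_mul, abs_of_pos hqR, abs_of_pos hqR']
          gcongr
      _ = _ := by ring
  set g := Int.gcd (Int.gcd D l0) l1 with hg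
  have hg0 : 0 < g := by
    apply Int.gcd_pos_of_ne_zero_left
    have := Int.gcd_pos_of_ne_zero_left l0 hD
    omega
  have hg0Z : (0 : ℤ) < g := by exact_mod_cast hg0
  have d0 : (g : ℤ) ∣ Int.gcd D l0 := Int.gcd_dvd_left _ _
  obtain ⟨x, hx⟩ : (g : ℤ) ∣ D := d0.trans (Int.gcd_dvd_left _ _)
  obtain ⟨y, hy⟩ : (g : ℤ) ∣ l0 := d0.trans (Int.gcd_dvd_right _ _)
  obtain ⟨z, hz⟩ : (g : ℤ) ∣ l1 := Int.gcd_dvd_right _ _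
  have hbez : ∃ u v w : ℤ, x * u + y * v + z * w = 1 := by
    have b1 := Int.gcd_eq_gcd_ab (Int.gcd D l0) l1
    have b2 := Int.gcd_eq_gcd_ab D l0
    rw [← hg] at b1
    set A1 := Int.gcdA (Int.gcd D l0) l1
    set B1 := Int.gcdB (Int.gcd D l0) l1
    set A2 := Int.gcdA D l0
    set B2 := Int.gcdB D l0
    refine ⟨A2 * A1, B2 * A1, B1, ?_⟩
    rw [b2] at b1
    apply mul_left_cancel₀ hg0Z.ne'
    have : (g : ℤ) * (x * (A2 * A1) + y * (B2 * A1) + z * B1) =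
      ((g * x) * A2 + (g * y) * B2) * A1 + (g * z) * B1 := by ring
    rw [this, ← hx, ← hy, ← hz, mul_one]
    exact b1.symm
  have hrel' : x * m = y * p + z * q := by
    apply mul_left_cancel₀ hg0Z.ne'
    calc (g : ℤ) * (x * m) = (g * x) * m := by ring
      _ = (g * y) * p + (g * z) * q := by rw [← hx, ← hy, ← hz, hrel]
      _ = _ := by ring
  have hb' : |(y : ℝ) - a * x| ≤ 2 * η * Q := by
    refine le_trans ?_ hb
    have hg1 : (1 : ℝ) ≤ g := by exact_mod_cast hg0
    have e : (l0 : ℝ) - a * D = g * (y - a * x) := by rw [hx, hy]; push_cast; ring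
    rw [e, abs_mul, Nat.abs_cast]
    nlinarith [abs_nonneg ((y : ℝ) - a * x)]
  have hx0 : x ≠ 0 := by
    rintro rfl
    simp at hx; exact hD hx
  have hxD : |x| ≤ |D| := by
    rw [hx, abs_mul, Nat.abs_cast]
    nlinarith [abs_nonneg x]
  obtain ⟨u, v, w, huvw⟩ := hbez
  rcases lt_or_gt_of_ne hx0 with hneg | hpos
  · have hc : ((-x).toNat : ℤ) = -x := Int.toNat_of_nonneg (by omega)
    have hcR : (((-x).toNat : ℕ) : ℝ) = -x := by exact_mod_cast hc
    refine ⟨(-x).toNat, -y, -z, by omega, ?_, ?_, ?_, -u, -v, -w, ?_⟩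
    · rw [hc]; exact (neg_le_abs x).trans hxD
    · rw [hcR, ← abs_neg]; push_cast
      convert hb' using 2; ring
    · rw [hc]; linarith
    · rw [hc]; linarith
  · have hc : (x.toNat : ℤ) = x := Int.toNat_of_nonneg (by omega)
    have hcR : ((x.toNat : ℕ) : ℝ) = x := by exact_mod_cast hc
    refine ⟨x.toNat, y, z, by omega, ?_, ?_, ?_, u, v, w, ?_⟩
    · rw [hc]; exact (le_abs_self x).trans hxD
    · rw [hcR]; exact hb'
    · rw [hc]; linarith
    · rw [hc]; linarith

/-- two primitive vectors with the same slope coincide -/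
theorem pp_prim_eq {p q p' q' : ℤ} (hq : 0 < q) (hq' : 0 < q') (h : Int.gcd p q = 1)
    (h' : Int.gcd p' q' = 1) (e : p * q' - p' * q = 0) : p = p' ∧ q = q' := by
  have e1 : p * q' = p' * q := by linarith
  have c : IsCoprime p q := Int.isCoprime_iff_gcd_eq_one.mpr h
  have c' : IsCoprime p' q' := Int.isCoprime_iff_gcd_eq_one.mpr h'
  have d1 : q ∣ q' := c.symm.dvd_of_dvd_mul_left (Dvd.intro_left p' e1.symm)
  have d2 : q' ∣ q := c'.symm.dvd_of_dvd_mul_left (Dvd.intro_left p e1)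
  have : q = q' := Int.dvd_antisymm hq.le hq'.le d1 d2
  subst this
  exact ⟨mul_right_cancel₀ hq.ne' e1, rfl⟩

def PPV (a b η : ℝ) (k : ℕ) (l l' : ℤ) (v : ℤ × ℤ) : Prop :=
  (∃ x y z : ℤ, k * x + l * y + l' * z = 1) ∧ (∃ m : ℤ, (k : ℤ) * m = l * v.1 + l' * v.2) ∧
  |((l : ℝ) - a * k) * v.1 + ((l' : ℝ) - b * k) * v.2| ≤ k * η

open Classical in
theorem pp_V_card {a b η Q : ℝ} (hη : 0 ≤ η) (hQ : 0 < Q) (P : Finset (ℤ × ℤ))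
    (hP : ∀ v ∈ P, 19 / 20 * Q < v.2 ∧ (v.2 : ℝ) ≤ Q ∧ Int.gcd v.1 v.2 = 1)
    (k : ℕ) (hk : 0 < k) (l l' : ℤ) (hω : 0 < |(l : ℝ) - a * k|) :
    ((P.filter (PPV a b η k l l')).card : ℝ) ≤ 4 * η * Q / |(l : ℝ) - a * k| + 1 := by
  set ω := (l : ℝ) - a * k with hωd
  set ω' := (l' : ℝ) - b * k with hωd'
  have hkR : (0 : ℝ) < k := by exact_mod_cast hk
  have hω0 : ω ≠ 0 := abs_pos.mp hω
  have hQpos : ∀ v ∈ P, (0 : ℝ) < v.2 := fun v hv => by have := (hP v hv).1; linarith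
  have hin : ∀ v ∈ P.filter (PPV a b η k l l'),
      |(v.1 : ℝ) / v.2 + ω' / ω| ≤ 2 * k * η / (Q * |ω|) := by
    intro v hv
    obtain ⟨hv, hV⟩ := Finset.mem_filter.mp hv
    have h0 := hQpos v hv
    have h1 : |ω * v.1 + ω' * v.2| ≤ k * η := hV.2.2
    have e : (v.1 : ℝ) / v.2 + ω' / ω = (ω * v.1 + ω' * v.2) / (v.2 * ω) := by
      field_simp
    rw [e, abs_div, abs_mul, abs_of_pos h0, div_le_div_iff₀ (by positivity) (by positivity)]
    have h2 : Q ≤ 2 * v.2 := by have := (hP v hv).1; linarith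
    calc |ω * v.1 + ω' * v.2| * (Q * |ω|) ≤ (k * η) * ((2 * v.2) * |ω|) := by gcongr
      _ = _ := by ring
  have := pp_sep (P.filter (PPV a b η k l l')) (fun v => (v.1 : ℝ) / v.2) (k / Q ^ 2)
    (-(ω' / ω) - 2 * k * η / (Q * |ω|)) (4 * k * η / (Q * |ω|)) (by positivity) (by positivity) ?_ ?_ ?_
  · refine this.trans (le_of_eq ?_)
    field_simp
  · intro v hv w hw hvw
    obtain ⟨hv, hV⟩ := Finset.mem_filter.mp hv
    obtain ⟨hw, hW⟩ := Finset.mem_filter.mp hw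
    obtain ⟨⟨x, y, z, hxyz⟩, ⟨m, hm⟩, _⟩ := hV
    obtain ⟨_, ⟨m', hm'⟩, _⟩ := hW
    have h0 := hQpos v hv
    have h0' := hQpos w hw
    have hDne : v.1 * w.2 - w.1 * v.2 ≠ 0 := by
      intro h
      have := pp_prim_eq (by exact_mod_cast h0) (by exact_mod_cast h0') (hP v hv).2.2 (hP w hw).2.2 h
      exact hvw (Prod.ext this.1 this.2)
    have hdvd : (k : ℤ) ∣ v.1 * w.2 - w.1 * v.2 := by
      have e1 : (v.1 * w.2 - w.1 * v.2) =
        k * (x * (v.1 * w.2 - w.1 * v.2) + y * (m * w.2 - m' * v.2) + z * (m' * v.1 - m * w.1)) := by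
        have : (k : ℤ) * (x * (v.1 * w.2 - w.1 * v.2) + y * (m * w.2 - m' * v.2) + z * (m' * v.1 - m * w.1))
          = k * x * (v.1 * w.2 - w.1 * v.2) + y * ((k * m) * w.2 - (k * m') * v.2) + z * ((k * m') * v.1 - (k * m) * w.1) := by ring
        rw [this, hm, hm']
        linear_combination (-(v.1 * w.2 - w.1 * v.2)) * hxyz
      exact Dvd.intro _ e1.symm
    have hle : (k : ℤ) ≤ |v.1 * w.2 - w.1 * v.2| :=
      Int.le_of_dvd (abs_pos.mpr hDne) ((dvd_abs _ _).mpr hdvd)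
    have hleR : (k : ℝ) ≤ |(v.1 : ℝ) * w.2 - w.1 * v.2| := by exact_mod_cast hle
    have e : (v.1 : ℝ) / v.2 - w.1 / w.2 = (v.1 * w.2 - w.1 * v.2) / (v.2 * w.2) := by
      field_simp
    rw [e, abs_div, abs_of_pos (mul_pos h0 h0')]
    have := (hP v hv).2.1
    have := (hP w hw).2.1
    have : (v.2 : ℝ) * w.2 ≤ Q ^ 2 := by nlinarith
    gcongr
  · intro v hv
    have := (abs_le.mp (hin v hv)).1
    linarith
  · intro v hv
    have := (abs_le.mp (hin v hv)).2
    have e : 4 * k * η / (Q * |ω|) = 2 * k * η / (Q * |ω|) + 2 * k * η / (Q * |ω|) := by ring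
    rw [e]; linarith

theorem pp_cardIcc (x r : ℝ) (hr : 0 ≤ r) : ((Finset.Icc ⌈x - r⌉ ⌊x + r⌋).card : ℝ) ≤ 2 * r + 1 := by
  apply pp_sepInt _ (x - r) _ (by positivity)
  · intro y hy
    exact Int.ceil_le.mp (Finset.mem_Icc.mp hy).1
  · intro y hy
    have := Int.le_floor.mp (Finset.mem_Icc.mp hy).2
    linarith

set_option maxHeartbeats 1000000 in
open Classical in
theorem pp_bad {a b E δ : ℝ} {h : ℕ} (hE : 1 ≤ E) (hδ : 0 < δ)
    (H : ∀ q : ℕ, 0 < q → (q : ℝ) ≤ E ^ 9 → ∀ m m' : ℤ,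
      δ ≤ E ^ h * max |q * a - m| |q * b - m'|)
    {C Q η N : ℝ} (hC : 1 ≤ C) (hη : 0 ≤ η) (hQ : 0 < Q) (hN0 : 0 ≤ N) (hN : N ≤ E)
    (hNη : N * η ≤ 1) (hηQ : 1 ≤ η * Q) (hQE : 4 * E ^ h / δ ≤ Q)
    (P : Finset (ℤ × ℤ))
    (hP : ∀ v ∈ P, 19 / 20 * Q < v.2 ∧ (v.2 : ℝ) ≤ Q ∧ |(v.1 : ℝ)| ≤ C * v.2 ∧
      PPNear (v.1 * a + v.2 * b) η ∧ Int.gcd v.1 v.2 = 1) :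
    ((P.filter (fun v => ∃ w ∈ P, w ≠ v ∧ |(v.1 : ℝ) * w.2 - w.1 * v.2| ≤ N)).card : ℝ) ≤
      165 * C * N * (η * Q) ^ 2 + 8 * C * N * (η * Q) * E ^ h / δ := by
  have hEh : 0 < E ^ h := by positivity
  set μ := δ / (2 * C * E ^ h) with hμ
  have hμ0 : 0 < μ := by positivity
  set L : ℕ → Finset ℤ := fun k =>
    (Finset.Icc ⌈a * k - 2 * η * Q⌉ ⌊a * k + 2 * η * Q⌋).filter (fun l => μ ≤ |(l : ℝ) - a * k|) with hL
  set L' : ℕ → ℤ → Finset ℤ := fun k l =>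
    Finset.Icc ⌈b * k - 2 * C * |(l : ℝ) - a * k|⌉ ⌊b * k + 2 * C * |(l : ℝ) - a * k|⌋ with hL'
  have hsub : P.filter (fun v => ∃ w ∈ P, w ≠ v ∧ |(v.1 : ℝ) * w.2 - w.1 * v.2| ≤ N) ⊆
      (Finset.Icc 1 ⌊N⌋₊).biUnion (fun k => (L k).biUnion (fun l => (L' k l).biUnion (fun l' =>
        P.filter (PPV a b η k l l')))) := by
    intro v hv
    obtain ⟨hv, w, hw, hwv, hD⟩ := Finset.mem_filter.mp hv
    obtain ⟨v1, v2, v3, ⟨m, hm⟩, v5⟩ := hP v hv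
    obtain ⟨w1, w2, w3, ⟨m', hm'⟩, w5⟩ := hP w hw
    have v0 : (0 : ℝ) < v.2 := by linarith
    have w0 : (0 : ℝ) < w.2 := by linarith
    have v0' : 0 < v.2 := by exact_mod_cast v0
    have w0' : 0 < w.2 := by exact_mod_cast w0
    have hDne : v.1 * w.2 - w.1 * v.2 ≠ 0 := by
      intro h
      have := pp_prim_eq v0' w0' v5 w5 h
      exact hwv (Prod.ext this.1.symm this.2.symm)
    obtain ⟨k, l, l', hk, hkD, hl, hrel, hbez⟩ := pp_wit v0' w0' v2 w2 hm hm' hDne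
    have hkN : (k : ℝ) ≤ N := by
      have : (k : ℝ) ≤ |(v.1 : ℝ) * w.2 - w.1 * v.2| := by exact_mod_cast hkD
      linarith
    have hk1 : (1 : ℝ) ≤ k := by exact_mod_cast hk
    have hrelR : (k : ℝ) * m = l * v.1 + l' * v.2 := by exact_mod_cast hrel
    have hV3 : |((l : ℝ) - a * k) * v.1 + ((l' : ℝ) - b * k) * v.2| ≤ k * η := by
      have e : ((l : ℝ) - a * k) * v.1 + ((l' : ℝ) - b * k) * v.2 = -(k * (v.1 * a + v.2 * b - m)) := by
        linear_combination -hrelR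
      rw [e, abs_neg, abs_mul, Nat.abs_cast]
      gcongr
    set ω := (l : ℝ) - a * k with hω
    set ω' := (l' : ℝ) - b * k with hω'
    have h1 : |ω'| ≤ 2 / Q + C * |ω| := by
      have e : |ω'| * v.2 ≤ 1 + C * |ω| * v.2 := by
        calc |ω'| * v.2 = |ω' * v.2| := by rw [abs_mul, abs_of_pos v0]
          _ = |(ω * v.1 + ω' * v.2) - ω * v.1| := by ring_nf
          _ ≤ |ω * v.1 + ω' * v.2| + |ω * v.1| := abs_sub _ _
          _ ≤ 1 + |ω| * (C * v.2) := by
              rw [abs_mul ω]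
              have : (k : ℝ) * η ≤ N * η := by gcongr
              gcongr
              linarith
          _ = _ := by ring
      have e2 : |ω'| ≤ 1 / v.2 + C * |ω| := by
        have : |ω'| ≤ (1 + C * |ω| * v.2) / v.2 := by rw [le_div_iff₀ v0]; exact e
        refine this.trans (le_of_eq ?_)
        field_simp
      have e3 : 1 / (v.2 : ℝ) ≤ 2 / Q := by
        rw [div_le_div_iff₀ v0 hQ]; linarith
      linarith
    have h2 : 2 / Q ≤ δ / E ^ h / 2 := by
      rw [div_le_iff₀ hδ] at hQE
      rw [div_div, div_le_div_iff₀ hQ (by positivity)]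
      linarith
    have h3 : δ / E ^ h ≤ max |ω| |ω'| := by
      rw [div_le_iff₀ hEh]
      have := H k hk (hkN.trans (hN.trans (le_self_pow₀ hE (by norm_num)))) l l'
      rw [abs_sub_comm, abs_sub_comm (k * b)] at this
      rw [hω, hω', mul_comm a, mul_comm b, mul_comm (max _ _)]
      exact this
    have hm0 : 0 < δ / E ^ h := by positivity
    have h4 : δ / E ^ h / 2 ≤ C * |ω| := by
      have hCω : |ω| ≤ C * |ω| := le_mul_of_one_le_left (abs_nonneg _) hC
      rcases le_max_iff.mp h3 with h | h <;> linarith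
    have h5 : μ ≤ |ω| := by
      have : μ = δ / E ^ h / 2 / C := by rw [hμ]; field_simp
      rw [this, div_le_iff₀ (by linarith)]; linarith
    have h6 : |ω'| ≤ 2 * C * |ω| := by linarith
    rw [Finset.mem_biUnion]
    refine ⟨k, Finset.mem_Icc.mpr ⟨hk, Nat.le_floor hkN⟩, ?_⟩
    rw [Finset.mem_biUnion]
    refine ⟨l, Finset.mem_filter.mpr ⟨Finset.mem_Icc.mpr ⟨?_, ?_⟩, h5⟩, ?_⟩
    · rw [Int.ceil_le]; have := (abs_le.mp hl).1; linarith
    · rw [Int.le_floor]; have := (abs_le.mp hl).2; linarith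
    rw [Finset.mem_biUnion]
    refine ⟨l', Finset.mem_Icc.mpr ⟨?_, ?_⟩, Finset.mem_filter.mpr ⟨hv, hbez, ⟨m, hrel⟩, hV3⟩⟩
    · rw [Int.ceil_le]; have := (abs_le.mp h6).1; linarith
    · rw [Int.le_floor]; have := (abs_le.mp h6).2; linarith
  set X := η * Q with hX
  have hl'sum : ∀ k ∈ Finset.Icc 1 ⌊N⌋₊, ∀ l ∈ L k,
      (((L' k l).biUnion (fun l' => P.filter (PPV a b η k l l'))).card : ℝ) ≤
        33 * C * X + (if l = round (a * k) then 4 * X / μ else 0) := by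
    intro k hk l hl
    obtain ⟨hl1, hl2⟩ := Finset.mem_filter.mp hl
    have hl1 := Finset.mem_Icc.mp hl1
    have hk0 : 0 < k := (Finset.mem_Icc.mp hk).1
    have hω0 : 0 < |(l : ℝ) - a * k| := lt_of_lt_of_le hμ0 hl2
    have hωX : |(l : ℝ) - a * k| ≤ 2 * X := by
      have g1 := Int.ceil_le.mp hl1.1
      have g2 := Int.le_floor.mp hl1.2
      rw [abs_le, hX]; constructor <;> linarith
    have s1 : (((L' k l).biUnion (fun l' => P.filter (PPV a b η k l l'))).card : ℝ) ≤
        ∑ l' ∈ L' k l, ((P.filter (PPV a b η k l l')).card : ℝ) := by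
      exact_mod_cast Finset.card_biUnion_le
    have s2 : ∑ l' ∈ L' k l, ((P.filter (PPV a b η k l l')).card : ℝ) ≤
        ∑ l' ∈ L' k l, (4 * η * Q / |(l : ℝ) - a * k| + 1) :=
      Finset.sum_le_sum (fun l' _ => pp_V_card hη hQ P
        (fun v hv => ⟨(hP v hv).1, (hP v hv).2.1, (hP v hv).2.2.2.2⟩) k hk0 l l' hω0)
    rw [Finset.sum_const, nsmul_eq_mul] at s2
    have s3 := pp_cardIcc (b * k) (2 * C * |(l : ℝ) - a * k|) (by positivity)
    refine s1.trans (s2.trans ?_)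
    set ω := |(l : ℝ) - a * k| with hω
    have s4 : ((L' k l).card : ℝ) * (4 * η * Q / ω + 1) ≤ (2 * (2 * C * ω) + 1) * (4 * η * Q / ω + 1) := by
      gcongr
    have s5 : (2 * (2 * C * ω) + 1) * (4 * η * Q / ω + 1) = 16 * C * X + 4 * C * ω + 1 + 4 * X / ω := by
      rw [hX]; field_simp; ring
    have s6 : 4 * C * ω ≤ 8 * C * X := by nlinarith
    have hCX : X ≤ C * X := le_mul_of_one_le_left (by linarith) hC
    split_ifs with hr
    · have : 4 * X / ω ≤ 4 * X / μ := by gcongr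
      linarith
    · have hhalf : 1 / 2 ≤ ω := by
        by_contra hc
        push Not at hc
        apply hr
        symm
        have r1 := abs_sub_round (a * k)
        have r2 : |((round (a * k) - l : ℤ) : ℝ)| < 1 := by
          push_cast
          calc |((round (a * (k : ℝ)) : ℤ) : ℝ) - l| = |(a * k - l) - (a * k - (round (a * (k : ℝ)) : ℤ))| := by ring_nf
            _ ≤ |a * k - l| + |a * k - (round (a * (k : ℝ)) : ℤ)| := abs_sub _ _
            _ < 1 := by rw [abs_sub_comm (a * k) l]; linarith
        have r3 : |round (a * (k : ℝ)) - l| < 1 := by exact_mod_cast r2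
        have := Int.abs_lt_one_iff.mp r3
        linarith
      have : 4 * X / ω ≤ 8 * X := by
        rw [div_le_iff₀ hω0]; nlinarith
      linarith
  have hlsum : ∀ k ∈ Finset.Icc 1 ⌊N⌋₊,
      (((L k).biUnion (fun l => (L' k l).biUnion (fun l' => P.filter (PPV a b η k l l')))).card : ℝ) ≤
        165 * C * X ^ 2 + 4 * X / μ := by
    intro k hk
    have s1 : (((L k).biUnion (fun l => (L' k l).biUnion (fun l' => P.filter (PPV a b η k l l')))).card : ℝ) ≤
        ∑ l ∈ L k, (((L' k l).biUnion (fun l' => P.filter (PPV a b η k l l'))).card : ℝ) := by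
      exact_mod_cast Finset.card_biUnion_le
    refine s1.trans ((Finset.sum_le_sum (hl'sum k hk)).trans ?_)
    rw [Finset.sum_add_distrib, Finset.sum_const, nsmul_eq_mul, Finset.sum_ite_eq']
    have c1 : ((L k).card : ℝ) ≤ 5 * X := by
      have g1 : ((L k).card : ℝ) ≤ (Finset.Icc ⌈a * k - 2 * η * Q⌉ ⌊a * k + 2 * η * Q⌋).card := by
        exact_mod_cast Finset.card_le_card (Finset.filter_subset _ _)
      have g2 := pp_cardIcc (a * k) (2 * η * Q) (by positivity)
      have : 2 * (2 * η * Q) + 1 ≤ 5 * X := by rw [hX] at *; linarith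
      linarith
    have c2 : (if round (a * (k : ℝ)) ∈ L k then 4 * X / μ else 0) ≤ 4 * X / μ := by
      split_ifs
      · exact le_rfl
      · positivity
    have c3 : ((L k).card : ℝ) * (33 * C * X) ≤ 5 * X * (33 * C * X) := by gcongr
    nlinarith
  have t1 : ((P.filter (fun v => ∃ w ∈ P, w ≠ v ∧ |(v.1 : ℝ) * w.2 - w.1 * v.2| ≤ N)).card : ℝ) ≤
      ∑ k ∈ Finset.Icc 1 ⌊N⌋₊, (((L k).biUnion (fun l => (L' k l).biUnion (fun l' => P.filter (PPV a b η k l l')))).card : ℝ) := by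
    exact_mod_cast (Finset.card_le_card hsub).trans Finset.card_biUnion_le
  refine t1.trans ((Finset.sum_le_sum hlsum).trans ?_)
  rw [Finset.sum_const, nsmul_eq_mul, Nat.card_Icc, Nat.add_sub_cancel]
  calc (⌊N⌋₊ : ℝ) * (165 * C * X ^ 2 + 4 * X / μ) ≤ N * (165 * C * X ^ 2 + 4 * X / μ) := by
        gcongr
        exact Nat.floor_le hN0
    _ = _ := by rw [hμ]; field_simp; ring

set_option maxHeartbeats 1000000 in
open Classical in
theorem pp_comb {a b : ℝ} {h : ℕ} {δ : ℝ} (hδ : 0 < δ) 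
    (HH : ∀ E : ℝ, 1 ≤ E → ∀ q : ℕ, 0 < q → (q : ℝ) ≤ E ^ 9 → ∀ m m' : ℤ,
      δ ≤ E ^ h * max |q * a - m| |q * b - m'|)
    {α β C : ℝ} (hαβ : α < β) (hC : 1 ≤ C) (hα : |α| ≤ C) (hβ : |β| ≤ C) :
    ∃ E0 r0 : ℝ, 1 ≤ E0 ∧ 0 < r0 ∧ ∀ E η N Q : ℝ, E0 ≤ E → 0 < η → 1 ≤ 2 * η * E ^ 2 → η * E ≤ 1 →
      0 ≤ N → N ≤ E → N * η ≤ r0 → E ^ (h + 15) ≤ Q →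
      ∃ G : Finset (ℤ × ℤ), (∀ v ∈ G, 0 < (v.2 : ℝ) ∧ (v.2 : ℝ) ≤ Q ∧ α * v.2 ≤ v.1 ∧
          (v.1 : ℝ) ≤ β * v.2 ∧ PPNear (v.1 * a + v.2 * b) η) ∧
        (∀ v ∈ G, ∀ w ∈ G, v ≠ w → N < |(v.1 : ℝ) * w.2 - w.1 * v.2|) ∧
        (β - α) * η * Q ^ 2 / 200 ≤ (G.card : ℝ) := by
  have hγ : 0 < β - α := by linarith
  set γ := β - α with hγd
  set L := 4 + 4 * γ + 24 * C / δ with hL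
  have hL0 : 0 < L := by positivity
  have hC0 : 0 < C := by linarith
  refine ⟨300 + 4 / δ + 2 / γ + 2000 * L / γ + 8000 * C / (δ * γ), min 1 (γ / (165000 * C)), ?_, ?_, ?_⟩
  · have : 0 < 4 / δ := by positivity
    have : 0 < 2 / γ := by positivity
    have : 0 < 2000 * L / γ := by positivity
    have : 0 < 8000 * C / (δ * γ) := by positivity
    linarith
  · positivity
  intro E η N Q hE hη hη1 hη2 hN0 hN hNη hQ
  have t1 : 0 < 4 / δ := by positivity
  have t2 : 0 < 2 / γ := by positivity
  have t3 : 0 < 2000 * L / γ := by positivity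
  have t4 : 0 < 8000 * C / (δ * γ) := by positivity
  have hE1 : 300 ≤ E := by linarith
  have hE2 : 4 / δ ≤ E := by linarith
  have hE3 : 2 / γ ≤ E := by linarith
  have hE4 : 2000 * L / γ ≤ E := by linarith
  have hE5 : 8000 * C / (δ * γ) ≤ E := by linarith
  clear hE
  have hE0 : 0 < E := by linarith
  have hN1 : N * η ≤ 1 := hNη.trans (min_le_left _ _)
  have hN2 : N * η ≤ γ / (165000 * C) := hNη.trans (min_le_right _ _)
  have hEQ : ∀ k ≤ h + 15, E ^ k ≤ Q := fun k hk => (pow_le_pow_right₀ (by linarith) hk).trans hQ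
  have hQ0 : 0 < Q := lt_of_lt_of_le (by positivity) hQ
  have hη4 : η ≤ 1 / 4 := by
    rw [le_div_iff₀ (by norm_num)]
    nlinarith
  have hηQ : 1 ≤ η * Q := by
    have h3 := hEQ 3 (by omega)
    have : 1 ≤ η * E ^ 3 := by
      have : E ^ 3 = E * E ^ 2 := by ring
      rw [this]
      nlinarith [mul_pos hη (pow_pos hE0 2)]
    exact this.trans (by gcongr)
  have hQE : 4 * E ^ h / δ ≤ Q := by
    calc 4 * E ^ h / δ = 4 / δ * E ^ h := by ring
      _ ≤ E * E ^ h := by gcongr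
      _ = E ^ (h + 1) := by ring
      _ ≤ Q := hEQ _ (by omega)
  have hR : 100 / η ≤ (⌈100 / η⌉₊ : ℝ) := Nat.le_ceil _
  have hRE : ((⌈100 / η⌉₊ : ℕ) : ℝ) ≤ E ^ 3 := by
    have h1 := (Nat.ceil_lt_add_one (show 0 ≤ 100 / η by positivity)).le
    have h2 : 100 / η ≤ 200 * E ^ 2 := by
      rw [div_le_iff₀ hη]
      nlinarith
    have h3 : (300 : ℝ) * E ^ 2 ≤ E * E ^ 2 := by gcongr
    nlinarith [one_le_pow₀ (show 1 ≤ E by linarith) (n := 2)]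
  have hprim := pp_prim (by linarith) hδ (HH E (by linarith)) hαβ hC hα hβ hη hη4 hR hRE hQ hE3
  set P := (PPOm α β C Q 1).filter (fun v => PPNear (v.1 * a + v.2 * b) η ∧ Int.gcd v.1 v.2 = 1) with hPd
  have hP : ∀ v ∈ P, (19 / 20 * Q < v.2 ∧ (v.2 : ℝ) ≤ Q ∧ α * v.2 ≤ v.1 ∧ (v.1 : ℝ) ≤ β * v.2) ∧
      PPNear (v.1 * a + v.2 * b) η ∧ Int.gcd v.1 v.2 = 1 := by
    intro v hv
    rw [hPd, Finset.mem_filter, pp_mem_om hQ0 (by norm_num) hα hβ] at hv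
    simpa using hv
  have hbad := pp_bad (by linarith) hδ (HH E (by linarith)) hC hη.le hQ0 hN0 hN hN1 hηQ hQE P (by
    intro v hv
    obtain ⟨⟨h1, h2, h3, h4⟩, h5, h6⟩ := hP v hv
    refine ⟨h1, h2, ?_, h5, h6⟩
    have h7 : (0:ℝ) ≤ v.2 := by linarith
    rw [abs_le] at hα hβ ⊢
    constructor
    · have := mul_le_mul_of_nonneg_right hα.1 h7
      linarith
    · have := mul_le_mul_of_nonneg_right hβ.2 h7
      linarith)
  set Bd := P.filter (fun v => ∃ w ∈ P, w ≠ v ∧ |(v.1 : ℝ) * w.2 - w.1 * v.2| ≤ N) with hBd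
  refine ⟨P \ Bd, ?_, ?_, ?_⟩
  · intro v hv
    obtain ⟨⟨h1, h2, h3, h4⟩, h5, h6⟩ := hP v (Finset.mem_sdiff.1 hv).1
    exact ⟨by linarith, h2, h3, h4, h5⟩
  · intro v hv w hw hne
    rw [Finset.mem_sdiff] at hv hw
    by_contra hcon
    exact hv.2 (Finset.mem_filter.2 ⟨hv.1, w, hw.1, hne.symm, not_lt.1 hcon⟩)
  · have hc : ((P \ Bd).card : ℝ) = P.card - Bd.card := by
      have := Finset.card_sdiff_add_card_eq_card (Finset.filter_subset (fun v => ∃ w ∈ P, w ≠ v ∧ |(v.1 : ℝ) * w.2 - w.1 * v.2| ≤ N) P)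
      rw [← hBd] at this
      rw [eq_sub_iff_add_eq]
      exact_mod_cast this
    rw [hc]
    have hX0 : 0 < η * Q ^ 2 := by positivity
    have e1 : L * (Q ^ 2 / E ^ 3) ≤ 0.001 * (γ * η * Q ^ 2) := by
      have h1 : 2000 * L ≤ E * γ := by rwa [div_le_iff₀ hγ] at hE4
      have : L * (Q ^ 2 / E ^ 3) = L * Q ^ 2 / E ^ 3 := by ring
      rw [this, div_le_iff₀ (by positivity)]
      have : 0.001 * (γ * η * Q ^ 2) * E ^ 3 = (E * γ) * (2 * η * E ^ 2) * (0.0005 * Q ^ 2) := by ring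
      rw [this]
      calc L * Q ^ 2 = (2000 * L) * 1 * (0.0005 * Q ^ 2) := by ring
        _ ≤ _ := by gcongr
    have e2 : 165 * C * N * (η * Q) ^ 2 ≤ 0.001 * (γ * η * Q ^ 2) := by
      rw [le_div_iff₀ (by positivity)] at hN2
      calc 165 * C * N * (η * Q) ^ 2 = (N * η * (165000 * C)) * (0.001 * (η * Q ^ 2)) := by ring
        _ ≤ γ * (0.001 * (η * Q ^ 2)) := by gcongr
        _ = _ := by ring
    have e3 : 8 * C * N * (η * Q) * E ^ h / δ ≤ 0.001 * (γ * η * Q ^ 2) := by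
      rw [div_le_iff₀ (by positivity)] at hE5
      rw [div_le_iff₀ hδ]
      have h2 := hEQ (h + 2) (by omega)
      have h3 : 8000 * C * (E * E ^ h) ≤ (δ * γ) * Q := by
        calc 8000 * C * (E * E ^ h) ≤ (E * (δ * γ)) * (E * E ^ h) := by gcongr
          _ = (δ * γ) * E ^ (h + 2) := by ring
          _ ≤ _ := by gcongr
      calc 8 * C * N * (η * Q) * E ^ h ≤ 8 * C * E * (η * Q) * E ^ h := by gcongr
        _ = (8000 * C * (E * E ^ h)) * (0.001 * (η * Q)) := by ring
        _ ≤ (δ * γ) * Q * (0.001 * (η * Q)) := by gcongr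
        _ = _ := by ring
    have hX1 : 0 < γ * η * Q ^ 2 := by positivity
    linarith

theorem pp_vec {a b x r : ℝ} {t s : ℝ} {p q m : ℤ} (hr : 0 ≤ r) (hq : 0 < (q : ℝ))
    (hqQ : (q : ℝ) ≤ r * Real.exp (t + s))
    (hx : |x - p / q| ≤ Real.exp (-t - 2 * s))
    (hm : |p * a + q * b - m| ≤ r * Real.exp (-t) / 2)
    (ha : |a| * Real.exp (-s) ≤ Real.exp (-t) / 2) :
    ∃ v : Fin 3 → ℤ, v ≠ 0 ∧
      ‖(aM t s * uM (a * x + b) x).mulVec fun i => ((v i : ℝ))‖ ≤ r := by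
  refine ⟨![-m, -p, q], ?_, ?_⟩
  · intro h0
    have := congrFun h0 2
    simp at this
    rw [this] at hq
    simp at hq
  have hxq : |q * x - p| ≤ r * Real.exp (-s) := by
    have e : q * x - p = q * (x - p / q) := by field_simp
    rw [e, abs_mul, abs_of_pos hq]
    calc q * |x - p / q| ≤ (r * Real.exp (t + s)) * Real.exp (-t - 2 * s) := by gcongr
      _ = r * (Real.exp (t + s) * Real.exp (-t - 2 * s)) := by ring
      _ = _ := by rw [← Real.exp_add]; ring_nf
  have hy : |q * (a * x + b) - m| ≤ r * Real.exp (-t) := by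
    have e : q * (a * x + b) - m = (p * a + q * b - m) + a * (q * x - p) := by ring
    rw [e]
    calc _ ≤ |p * a + q * b - m| + |a * (q * x - p)| := abs_add_le _ _
      _ ≤ r * Real.exp (-t) / 2 + |a| * (r * Real.exp (-s)) := by
        rw [abs_mul]; gcongr
      _ = r * Real.exp (-t) / 2 + r * (|a| * Real.exp (-s)) := by ring
      _ ≤ r * Real.exp (-t) / 2 + r * (Real.exp (-t) / 2) := by gcongr
      _ = _ := by ring
  rw [pi_norm_le_iff_of_nonneg hr]
  have key : ∀ u z : ℝ, |z| ≤ r * Real.exp (-u) → |Real.exp u * z| ≤ r := by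
    intro u z hz
    rw [abs_mul, abs_of_pos (Real.exp_pos u)]
    calc Real.exp u * |z| ≤ Real.exp u * (r * Real.exp (-u)) := by gcongr
      _ = r * (Real.exp u * Real.exp (-u)) := by ring
      _ = r := by rw [← Real.exp_add]; simp
  intro i
  fin_cases i
  · have e : ((aM t s * uM (a * x + b) x).mulVec fun i => (((![-m, -p, q] : Fin 3 → ℤ) i : ℤ) : ℝ)) 0
        = Real.exp t * (q * (a * x + b) - m) := by
      simp [aM, uM, Matrix.mulVec, dotProduct, Fin.sum_univ_three, Matrix.mul_apply]
      ring
    show ‖((aM t s * uM (a * x + b) x).mulVec fun i => (((![-m, -p, q] : Fin 3 → ℤ) i : ℤ) : ℝ)) 0‖ ≤ r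
    rw [e]
    exact key _ _ hy
  · have e : ((aM t s * uM (a * x + b) x).mulVec fun i => (((![-m, -p, q] : Fin 3 → ℤ) i : ℤ) : ℝ)) 1
        = Real.exp s * (q * x - p) := by
      simp [aM, uM, Matrix.mulVec, dotProduct, Fin.sum_univ_three, Matrix.mul_apply]
      ring
    show ‖((aM t s * uM (a * x + b) x).mulVec fun i => (((![-m, -p, q] : Fin 3 → ℤ) i : ℤ) : ℝ)) 1‖ ≤ r
    rw [e]
    exact key _ _ hxq
  · have e : ((aM t s * uM (a * x + b) x).mulVec fun i => (((![-m, -p, q] : Fin 3 → ℤ) i : ℤ) : ℝ)) 2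
        = Real.exp (-t - s) * q := by
      simp [aM, uM, Matrix.mulVec, dotProduct, Fin.sum_univ_three, Matrix.mul_apply]
    show ‖((aM t s * uM (a * x + b) x).mulVec fun i => (((![-m, -p, q] : Fin 3 → ℤ) i : ℤ) : ℝ)) 2‖ ≤ r
    rw [e]
    apply key
    rw [abs_of_pos hq]
    convert hqQ using 3
    ring

theorem pp_meas {α β ρ Q : ℝ} (hρ : 0 < ρ) (hQ : 0 < Q) (G : Finset (ℤ × ℤ)) (S : Set ℝ)
    (hS : S ⊆ Set.Icc α β)
    (hG : ∀ v ∈ G, 0 < (v.2 : ℝ) ∧ (v.2 : ℝ) ≤ Q ∧ (α + ρ) * v.2 ≤ v.1 ∧ (v.1 : ℝ) ≤ (β - ρ) * v.2)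
    (hsep : ∀ v ∈ G, ∀ w ∈ G, v ≠ w → 2 * ρ * Q ^ 2 < |(v.1 : ℝ) * w.2 - w.1 * v.2|)
    (hGS : ∀ v ∈ G, ∀ x ∈ Set.Icc α β, |x - (v.1 : ℝ) / v.2| ≤ ρ → x ∈ S) :
    (G.card : ℝ) * (2 * ρ) ≤ (volume S).toReal := by
  have hfin : volume S ≠ ⊤ := by
    refine ne_top_of_le_ne_top ?_ (measure_mono hS)
    rw [Real.volume_Icc]; exact ENNReal.ofReal_ne_top
  let I : ℤ × ℤ → Set ℝ := fun v => Set.Icc ((v.1 : ℝ) / v.2 - ρ) ((v.1 : ℝ) / v.2 + ρ)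
  have hI : ∀ v ∈ G, ∀ x ∈ I v, x ∈ S := by
    intro v hv x hx
    obtain ⟨h1, h2, h3, h4⟩ := hG v hv
    have h5 : α + ρ ≤ (v.1 : ℝ) / v.2 := by rwa [le_div_iff₀ h1]
    have h6 : (v.1 : ℝ) / v.2 ≤ β - ρ := by rwa [div_le_iff₀ h1]
    have hx1 := hx.1
    have hx2 := hx.2
    refine hGS v hv x ⟨by linarith, by linarith⟩ ?_
    rw [abs_le]; constructor <;> linarith
  have hdisj : Set.PairwiseDisjoint (↑G : Set (ℤ × ℤ)) I := by
    intro v hv w hw hne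
    rw [Function.onFun, Set.disjoint_left]
    intro x hxv hxw
    obtain ⟨h1, h2, -, -⟩ := hG v hv
    obtain ⟨h1', h2', -, -⟩ := hG w hw
    have hs := hsep v hv w hw hne
    have e : (v.1 : ℝ) * w.2 - w.1 * v.2 = ((v.1 : ℝ) / v.2 - w.1 / w.2) * (v.2 * w.2) := by
      field_simp
    rw [e, abs_mul, abs_of_pos (mul_pos h1 h1')] at hs
    have hd : |(v.1 : ℝ) / v.2 - w.1 / w.2| ≤ 2 * ρ := by
      have a1 := hxv.1
      have a2 := hxv.2
      have a3 := hxw.1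
      have a4 := hxw.2
      rw [abs_le]; constructor <;> linarith
    have : |(v.1 : ℝ) / v.2 - w.1 / w.2| * (v.2 * w.2) ≤ 2 * ρ * Q ^ 2 := by
      rw [sq]; gcongr
    linarith
  have hm := measure_biUnion_finset (μ := volume) hdisj (fun v _ => measurableSet_Icc)
  have hsub : (⋃ v ∈ G, I v) ⊆ S := by
    intro x hx
    simp only [Set.mem_iUnion] at hx
    obtain ⟨v, hv, hx⟩ := hx
    exact hI v hv x hx
  have hle := measure_mono (μ := volume) hsub
  rw [hm] at hle
  have hv : ∀ v ∈ G, volume (I v) = ENNReal.ofReal (2 * ρ) := by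
    intro v _
    show volume (Set.Icc _ _) = _
    rw [Real.volume_Icc]; congr 1; ring
  rw [Finset.sum_congr rfl hv, Finset.sum_const, nsmul_eq_mul] at hle
  have := ENNReal.toReal_mono hfin hle
  rwa [ENNReal.toReal_mul, ENNReal.toReal_ofReal (by positivity), ENNReal.toReal_natCast] at this

set_option maxHeartbeats 1000000 in
/-- **Positive proportion of well-approximable points at every scale**
(Chow–Yang, estimate (3.5)). -/
theorem positive_proportion_at_scale (a b : ℝ) (hab : IsDiophantine a b)
    (A B : ℝ) (hAB : A < B) (ε : ℝ) (hε : 0 < ε) (hε1 : ε < 1) :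
    ∃ c₁ c₂ c₀ : ℝ, 0 < c₁ ∧ c₁ < c₂ ∧ c₂ < 1 ∧ 0 < c₀ ∧
      ∀ α β : ℝ, A ≤ α → α < β → β ≤ B →
        ∃ T₁ : ℝ, ∀ t s : ℕ, 0 < t → 0 < s →
          c₁ * (s : ℝ) ≤ (t : ℝ) → (t : ℝ) ≤ c₂ * (s : ℝ) →
          T₁ ≤ (s : ℝ) + (t : ℝ) →
          c₀ * (β - α) * ε ^ 3 / ((s : ℝ) + (t : ℝ)) ^ 2 ≤
            (volume {x ∈ Set.Icc α β | ∃ v : Fin 3 → ℤ, v ≠ 0 ∧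
              ‖(aM t s * uM (a * x + b) x).mulVec fun i => ((v i : ℝ))‖
                ≤ ε * ((s : ℝ) + (t : ℝ)) ^ (-(2 / 3) : ℝ)}).toReal := by
  obtain ⟨h, δ, hδ, hδ1, HH⟩ := pp_dioph hab
  set M : ℝ := ((h + 15 : ℕ) : ℝ) with hM
  have hM15 : 15 ≤ M := by rw [hM]; push_cast; linarith [(Nat.cast_nonneg h : (0:ℝ) ≤ h)]
  have hM0 : 0 < M := by linarith
  refine ⟨1 / (2 * M), 1 / M, 1 / 400, by positivity, ?_, ?_, by norm_num, ?_⟩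
  · rw [div_lt_div_iff₀ (by positivity) hM0]; linarith
  · rw [div_lt_one hM0]; linarith
  intro α β hα hαβ hβ
  have hγ : 0 < β - α := by linarith
  set C := max 1 (max |A| |B|) with hC
  have hC1 : 1 ≤ C := le_max_left _ _
  have hCA : |A| ≤ C := (le_max_left _ _).trans (le_max_right _ _)
  have hCB : |B| ≤ C := (le_max_right _ _).trans (le_max_right _ _)
  have hA' := abs_le.1 hCA
  have hB' := abs_le.1 hCB
  obtain ⟨E0, r0, hE0, hr0, hcomb⟩ := pp_comb hδ HH
    (α := α + (β - α) / 4) (β := β - (β - α) / 4) (C := C) (by linarith) hC1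
    (abs_le.2 ⟨by linarith, by linarith⟩) (abs_le.2 ⟨by linarith, by linarith⟩)
  set K := 8 + E0 + 1 / r0 + 2 * |a| + 4 / (β - α) + 2 * (2 * M + 1) / ε with hK
  refine ⟨(2 * M + 1) * K, ?_⟩
  intro t s ht hs h1 h2 hT
  have k1 : 0 < 1 / r0 := by positivity
  have k2 : 0 ≤ 2 * |a| := by positivity
  have k3 : 0 < 4 / (β - α) := by positivity
  have k4 : 0 < 2 * (2 * M + 1) / ε := by positivity
  generalize (t : ℝ) = t at *
  generalize (s : ℝ) = s at *
  have hs2 : s ≤ 2 * M * t := by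
    rw [div_mul_eq_mul_div, one_mul, div_le_iff₀ (by positivity)] at h1; linarith
  have hs1 : M * t ≤ s := by
    rw [div_mul_eq_mul_div, one_mul, le_div_iff₀ hM0] at h2; linarith
  have hTt : s + t ≤ (2 * M + 1) * t := by linarith
  have htK : K ≤ t := by
    have := hT.trans hTt
    exact le_of_mul_le_mul_left this (by linarith)
  have ht8 : 8 ≤ t := by linarith
  have htE : E0 ≤ t := by linarith
  have htr : 1 / r0 ≤ t := by linarith
  have hta : 2 * |a| ≤ t := by linarith
  have htγ : 4 / (β - α) ≤ t := by linarith
  have htε : 2 * (2 * M + 1) / ε ≤ t := by linarith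
  have hst : 2 * t ≤ s := by
    have : 2 * t ≤ M * t := by gcongr; linarith
    linarith
  set T := s + t with hTd
  have hT8 : t ≤ T := by linarith
  have hT0 : 0 < T := by linarith
  clear_value K
  set r := ε * T ^ (-(2 / 3) : ℝ) with hr
  have hrpos : 0 < r := by positivity
  have hr3 : r ^ 3 = ε ^ 3 / T ^ 2 := by
    rw [hr, mul_pow, div_eq_mul_inv]
    congr 1
    rw [← Real.rpow_natCast, ← Real.rpow_mul hT0.le, ← Real.rpow_natCast, ← Real.rpow_neg hT0.le]
    norm_num
  have hexp : t ≤ Real.exp t := by linarith [Real.add_one_le_exp t]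
  have hexp2 : t ^ 2 / 2 ≤ Real.exp t := by
    linarith [Real.quadratic_le_exp_of_nonneg (show 0 ≤ t by linarith)]
  have hrE : 1 ≤ r * Real.exp t := by
    have g1 : T⁻¹ ≤ T ^ (-(2 / 3) : ℝ) := by
      rw [← Real.rpow_neg_one]
      exact Real.rpow_le_rpow_of_exponent_le (by linarith) (by norm_num)
    have g2 : ((2 * M + 1) * t)⁻¹ ≤ T⁻¹ := by gcongr
    have g3 : ε * ((2 * M + 1) * t)⁻¹ * (t ^ 2 / 2) ≤ r * Real.exp t := by
      rw [hr]; gcongr; exact g2.trans g1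
    refine le_trans ?_ g3
    have ht0 : 0 < t := by linarith
    have e : ε * ((2 * M + 1) * t)⁻¹ * (t ^ 2 / 2) = ε * t / (2 * (2 * M + 1)) := by
      field_simp
    rw [e, le_div_iff₀ (by positivity), one_mul]
    rw [div_le_iff₀ hε] at htε
    linarith
  have hε3 : ε ^ 3 ≤ 1 := pow_le_one₀ hε.le hε1.le
  have hr3T : r ^ 3 ≤ 1 / T := by
    rw [hr3, div_le_div_iff₀ (by positivity) hT0]
    have g1 : ε ^ 3 * T ≤ 1 * T := by gcongr
    have g2 : T * 1 ≤ T * T := by gcongr; linarith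
    rw [sq]; linarith
  have hr3r0 : r ^ 3 ≤ r0 := by
    refine hr3T.trans ?_
    rw [div_le_iff₀ hT0]
    rw [div_le_iff₀ hr0] at htr
    have g : t * r0 ≤ T * r0 := by gcongr
    linarith
  have hr3h : r ^ 3 ≤ 1 / 8 := by
    refine hr3T.trans ?_
    rw [div_le_div_iff₀ hT0 (by norm_num)]; linarith
  have hrh : r ≤ 1 / 2 := by
    by_contra hcon
    have := pow_lt_pow_left₀ (not_le.1 hcon) (by norm_num) (n := 3) (by norm_num)
    norm_num at this
    linarith
  have hat : |a| * Real.exp (-s) ≤ Real.exp (-t) / 2 := by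
    have e : Real.exp (-t) = Real.exp (s - t) * Real.exp (-s) := by
      rw [← Real.exp_add]; ring_nf
    have g : t ≤ Real.exp (s - t) := hexp.trans (Real.exp_le_exp.2 (by linarith))
    rw [e]
    have g' : 2 * |a| * Real.exp (-s) ≤ Real.exp (s - t) * Real.exp (-s) := by
      gcongr; exact hta.trans g
    linarith
  set ρ := Real.exp (-t - 2 * s) with hρ
  have hρ0 : 0 < ρ := Real.exp_pos _
  have hργ : ρ ≤ (β - α) / 4 := by
    have g1 : ρ ≤ Real.exp (-t) := Real.exp_le_exp.2 (by linarith)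
    refine g1.trans ?_
    rw [Real.exp_neg, inv_le_comm₀ (Real.exp_pos t) (by positivity), inv_div]
    linarith
  set Q := r * Real.exp (t + s) with hQ
  have hQ0 : 0 < Q := by positivity
  have hQρ : ρ * Q ^ 2 = r ^ 2 * Real.exp t := by
    have : Real.exp (-t - 2 * s) * Real.exp (t + s) ^ 2 = Real.exp t := by
      rw [sq, ← Real.exp_add, ← Real.exp_add]; ring_nf
    rw [hQ, hρ, mul_pow, ← this]; ring
  have hEE : Real.exp t * Real.exp (-t) = 1 := by rw [← Real.exp_add]; simp
  obtain ⟨G, hG1, hG2, hG3⟩ := hcomb (Real.exp t) (r * Real.exp (-t) / 2) (2 * ρ * Q ^ 2) Q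
    (htE.trans hexp) (by positivity)
    (by
      have : 2 * (r * Real.exp (-t) / 2) * Real.exp t ^ 2
        = r * Real.exp t * (Real.exp t * Real.exp (-t)) := by ring
      rw [this, hEE, mul_one]; exact hrE)
    (by
      have : r * Real.exp (-t) / 2 * Real.exp t
        = r / 2 * (Real.exp t * Real.exp (-t)) := by ring
      rw [this, hEE]; linarith)
    (by positivity)
    (by
      rw [mul_assoc, hQρ]
      have g1 : r ^ 2 ≤ (1 / 2) ^ 2 := by gcongr
      have g2 : r ^ 2 * Real.exp t ≤ (1 / 2) ^ 2 * Real.exp t := by gcongr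
      linarith [Real.exp_pos t])
    (by
      have : 2 * ρ * Q ^ 2 * (r * Real.exp (-t) / 2) = r ^ 3 * (Real.exp t * Real.exp (-t)) := by
        rw [mul_assoc 2, hQρ]; ring
      rw [this, hEE, mul_one]; exact hr3r0)
    (by
      rw [← Real.exp_nat_mul, hQ, Real.exp_add, ← mul_assoc]
      have g : Real.exp (((h + 15 : ℕ) : ℝ) * t) ≤ Real.exp s := Real.exp_le_exp.2 hs1
      have g' : 1 * Real.exp s ≤ r * Real.exp t * Real.exp s := by gcongr
      linarith)
  have hfin := pp_meas (α := α) (β := β) hρ0 hQ0 G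
    {x ∈ Set.Icc α β | ∃ v : Fin 3 → ℤ, v ≠ 0 ∧
      ‖(aM t s * uM (a * x + b) x).mulVec fun i => ((v i : ℝ))‖ ≤ r}
    (fun x hx => hx.1)
    (fun v hv => by
      obtain ⟨g1, g2, g3, g4, -⟩ := hG1 v hv
      exact ⟨g1, g2, le_trans (by gcongr) g3, g4.trans (by gcongr)⟩)
    hG2
    (fun v hv x hx hxv => by
      obtain ⟨g1, g2, g3, g4, m, g5⟩ := hG1 v hv
      exact ⟨hx, pp_vec hrpos.le g1 g2 hxv g5 hat⟩)
  refine le_trans ?_ hfin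
  have e1 : (β - (β - α) / 4 - (α + (β - α) / 4)) * (r * Real.exp (-t) / 2) * Q ^ 2 / 200 * (2 * ρ)
      = 1 / 400 * (β - α) * (r ^ 3 * (Real.exp t * Real.exp (-t))) := by
    have : (β - (β - α) / 4 - (α + (β - α) / 4)) * (r * Real.exp (-t) / 2) * Q ^ 2 / 200 * (2 * ρ)
      = 1 / 400 * (β - α) * r * Real.exp (-t) * (ρ * Q ^ 2) := by ring
    rw [this, hQρ]; ring
  rw [hEE, mul_one, hr3] at e1
  rw [mul_div_assoc, ← e1]
  gcongr

end
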